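/- For all fixed reals 0 < α < 1/2 and 0 < ρ < 1 there exist constants c, k, n₀ ∈ ℕ such that the following holds for every n ≥ n₀, every integer r with 2 ≤ r ≤ (1−ρ)n, and all ℓ, u ∈ ℕⁿ with [ℓᵢ,uᵢ] ⊆ [r − r^α, r + r^α] and uᵢ ≤ ℓᵢ + 1 for all i: every eigenvalue λ ≠ 1 of the transition matrix P of the degree interval Markov chain on G(ℓ,u) satisfies λ ≤ 1 − 1/(c·n^k). (This is the spectral-gap formulation of the statement that the degree interval Markov chain is rapidly mixing on G(ℓ,u) for near-regular degree intervals of size at most one; P is symmetric with uniform stationary distribution, so all its eigenvalues are real.) -/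

import Mathlib

/-- The degree of vertex `i` in a simple graph on `Fin n`. -/
noncomputable def degOf {n : ℕ} (G : SimpleGraph (Fin n)) (i : Fin n) : ℕ :=
  (G.neighborSet i).ncard

/-- Membership in `G(ℓ,u)`: degrees within `[ℓ,u]` componentwise. -/
def memGlu (n : ℕ) (ℓ u : Fin n → ℕ) (G : SimpleGraph (Fin n)) : Prop :=
  ∀ i, ℓ i ≤ degOf G i ∧ degOf G i ≤ u i

/-- `S(G,G')`: the number of ordered 4-tuples `(v,w,x,y)` with `{v,w},{x,y} ∈ E(G)`,
`{v,y},{w,x} ∉ E(G)`, and `E(G') = (E(G)∖{{v,w},{x,y}}) ∪ {{v,y},{w,x}}`. -/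
noncomputable def switchCount {n : ℕ} (G G' : SimpleGraph (Fin n)) : ℕ :=
  {t : Fin n × Fin n × Fin n × Fin n |
    G.Adj t.1 t.2.1 ∧ G.Adj t.2.2.1 t.2.2.2 ∧
    ¬ G.Adj t.1 t.2.2.2 ∧ ¬ G.Adj t.2.1 t.2.2.1 ∧
    G'.edgeSet = (G.edgeSet \ {s(t.1, t.2.1), s(t.2.2.1, t.2.2.2)}) ∪
      {s(t.1, t.2.2.2), s(t.2.1, t.2.2.1)}}.ncard

/-- `F(G,G')`: the number of ordered triples `(v,w,x)` with `{v,w} ∈ E(G)`,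
`{w,x} ∉ E(G)`, and `E(G') = (E(G)∖{{v,w}}) ∪ {{w,x}}`. -/
noncomputable def hingeCount {n : ℕ} (G G' : SimpleGraph (Fin n)) : ℕ :=
  {t : Fin n × Fin n × Fin n |
    G.Adj t.1 t.2.1 ∧ ¬ G.Adj t.2.1 t.2.2 ∧
    G'.edgeSet = (G.edgeSet \ {s(t.1, t.2.1)}) ∪ {s(t.2.1, t.2.2)}}.ncard

/-- `D(G,G')`: the number of ordered pairs `(v,w)` of distinct vertices with
`E(G') = E(G) △ {{v,w}}`. -/
noncomputable def addDelCount {n : ℕ} (G G' : SimpleGraph (Fin n)) : ℕ :=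
  {t : Fin n × Fin n | t.1 ≠ t.2 ∧
    G'.edgeSet = symmDiff G.edgeSet {s(t.1, t.2)}}.ncard

/-- The transition matrix of the degree interval Markov chain on `G(ℓ,u)`:
off-diagonal entries `P(G,G') = S(G,G')/(6n⁴) + F(G,G')/(6n³) + D(G,G')/(6n²)`,
and diagonal entries `P(G,G) = 1 − Σ_{G'≠G} P(G,G')`. -/
noncomputable def diMatrix (n : ℕ) (ℓ u : Fin n → ℕ) :
    Matrix {G : SimpleGraph (Fin n) // memGlu n ℓ u G}
      {G : SimpleGraph (Fin n) // memGlu n ℓ u G} ℝ :=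
  letI : Fintype {G : SimpleGraph (Fin n) // memGlu n ℓ u G} := Fintype.ofFinite _
  letI : DecidableEq {G : SimpleGraph (Fin n) // memGlu n ℓ u G} := Classical.decEq _
  fun G G' =>
    if G = G' then
      1 - ∑ G'' ∈ Finset.univ.erase G,
        ((1 / (6 * (n : ℝ) ^ 4)) * switchCount G.1 G''.1 +
          (1 / (6 * (n : ℝ) ^ 3)) * hingeCount G.1 G''.1 +
          (1 / (6 * (n : ℝ) ^ 2)) * addDelCount G.1 G''.1)
    else
      (1 / (6 * (n : ℝ) ^ 4)) * switchCount G.1 G'.1 +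
        (1 / (6 * (n : ℝ) ^ 3)) * hingeCount G.1 G'.1 +
        (1 / (6 * (n : ℝ) ^ 2)) * addDelCount G.1 G'.1

/-- The eigenvalue equation `P v = λ v` (the state space is finite). -/
def IsEigenPair {S : Type} [Finite S] (P : Matrix S S ℝ) (lam : ℝ) (v : S → ℝ) : Prop :=
  letI : Fintype S := Fintype.ofFinite S
  P.mulVec v = lam • v

section gap

open Finset

/-- Add the edge `ab`. -/
def addE {n : ℕ} (G : SimpleGraph (Fin n)) (a b : Fin n) : SimpleGraph (Fin n) where
  Adj x y := G.Adj x y ∨ (a ≠ b ∧ ((x = a ∧ y = b) ∨ (x = b ∧ y = a)))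
  symm := ⟨by
    intro x y h
    rcases h with h | ⟨h, hab | hab⟩
    · exact Or.inl h.symm
    · exact Or.inr ⟨h, Or.inr ⟨hab.2, hab.1⟩⟩
    · exact Or.inr ⟨h, Or.inl ⟨hab.2, hab.1⟩⟩⟩
  loopless := ⟨by
    intro x h
    rcases h with h | ⟨h, hab | hab⟩
    · exact G.loopless.irrefl x h
    · exact h (hab.1.symm.trans hab.2)
    · exact h (hab.2.symm.trans hab.1)⟩

/-- Delete the edge `ab`. -/
def delE {n : ℕ} (G : SimpleGraph (Fin n)) (a b : Fin n) : SimpleGraph (Fin n) where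
  Adj x y := G.Adj x y ∧ ¬ ((x = a ∧ y = b) ∨ (x = b ∧ y = a))
  symm := ⟨by
    intro x y h
    exact ⟨h.1.symm, fun h' => h.2 (by tauto)⟩⟩
  loopless := ⟨fun x h => G.loopless.irrefl x h.1⟩

theorem addE_adj {n : ℕ} (G : SimpleGraph (Fin n)) (a b x y : Fin n) :
    (addE G a b).Adj x y ↔ G.Adj x y ∨ (a ≠ b ∧ ((x = a ∧ y = b) ∨ (x = b ∧ y = a))) := Iff.rfl

theorem delE_adj {n : ℕ} (G : SimpleGraph (Fin n)) (a b x y : Fin n) :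
    (delE G a b).Adj x y ↔ G.Adj x y ∧ ¬ ((x = a ∧ y = b) ∨ (x = b ∧ y = a)) := Iff.rfl

theorem addE_delE {n : ℕ} {G : SimpleGraph (Fin n)} {a b : Fin n} (h : G.Adj a b) :
    addE (delE G a b) a b = G := by
  ext x y
  have hne := h.ne
  have hs := h.symm
  rw [addE_adj, delE_adj]
  constructor
  · rintro (h1 | ⟨-, ⟨rfl, rfl⟩ | ⟨rfl, rfl⟩⟩)
    · exact h1.1
    · exact h
    · exact hs
  · intro h1
    tauto

theorem degOf_addE {n : ℕ} {G : SimpleGraph (Fin n)} {a b : Fin n} (hab : a ≠ b)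
    (h : ¬ G.Adj a b) (v : Fin n) :
    degOf (addE G a b) v =
      degOf G v + (if v = a then 1 else 0) + (if v = b then 1 else 0) := by
  unfold degOf
  have h' : ¬ G.Adj b a := fun h1 => h h1.symm
  by_cases hva : v = a
  · subst hva
    have : (addE G v b).neighborSet v = insert b (G.neighborSet v) := by
      ext y
      simp only [SimpleGraph.mem_neighborSet, addE_adj, Set.mem_insert_iff]
      tauto
    rw [this, Set.ncard_insert_of_notMem (by simpa using h)]
    simp [hab]
  · by_cases hvb : v = b
    · subst hvb
      have : (addE G a v).neighborSet v = insert a (G.neighborSet v) := by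
        ext y
        simp only [SimpleGraph.mem_neighborSet, addE_adj, Set.mem_insert_iff]
        tauto
      rw [this, Set.ncard_insert_of_notMem (by simpa using h')]
      simp [hva]
    · have : (addE G a b).neighborSet v = G.neighborSet v := by
        ext y
        simp only [SimpleGraph.mem_neighborSet, addE_adj]
        tauto
      rw [this]
      simp [hva, hvb]

theorem degOf_delE {n : ℕ} {G : SimpleGraph (Fin n)} {a b : Fin n} (h : G.Adj a b) (v : Fin n) :
    degOf (delE G a b) v + (if v = a then 1 else 0) + (if v = b then 1 else 0) = degOf G v := by
  have h1 : ¬ (delE G a b).Adj a b := by rw [delE_adj]; tauto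
  have := degOf_addE h.ne h1 v
  rw [addE_delE h] at this
  exact this.symm

/-- The adjacency relation as a function on ordered pairs. -/
def adjFun {n : ℕ} (G : SimpleGraph (Fin n)) : Fin n × Fin n → Prop := fun p => G.Adj p.1 p.2

theorem adjFun_injective {n : ℕ} : Function.Injective (adjFun (n := n)) := by
  intro G H h
  ext x y
  exact iff_of_eq (congrFun h (x, y))

open scoped Classical in
/-- The number of ordered pairs on which two graphs differ. -/
noncomputable def graphDist {n : ℕ} (A B : SimpleGraph (Fin n)) : ℕ :=
  hammingDist (adjFun A) (adjFun B)

theorem graphDist_comm {n : ℕ} (A B : SimpleGraph (Fin n)) : graphDist A B = graphDist B A :=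
  hammingDist_comm _ _

theorem graphDist_self {n : ℕ} (A : SimpleGraph (Fin n)) : graphDist A A = 0 :=
  hammingDist_self _

theorem graphDist_triangle {n : ℕ} (A B C : SimpleGraph (Fin n)) :
    graphDist A C ≤ graphDist A B + graphDist B C :=
  hammingDist_triangle _ _ _

theorem graphDist_eq_zero {n : ℕ} {A B : SimpleGraph (Fin n)} : graphDist A B = 0 ↔ A = B := by
  classical
  unfold graphDist
  rw [hammingDist_eq_zero]
  exact adjFun_injective.eq_iff

open scoped Classical in
theorem graphDist_eq_card {n : ℕ} (A B : SimpleGraph (Fin n)) :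
    graphDist A B = (univ.filter fun p : Fin n × Fin n => ¬ (A.Adj p.1 p.2 ↔ B.Adj p.1 p.2)).card := by
  unfold graphDist hammingDist adjFun
  congr 1
  ext p
  simp

theorem graphDist_addE_add_two {n : ℕ} {A B : SimpleGraph (Fin n)} {a b : Fin n}
    (hA : ¬ A.Adj a b) (hB : B.Adj a b) : graphDist (addE A a b) B + 2 = graphDist A B := by
  classical
  have hne := hB.ne
  have hB' := hB.symm
  have hA' : ¬ A.Adj b a := fun h => hA h.symm
  rw [graphDist_eq_card, graphDist_eq_card]
  have h2 : ({(a, b), (b, a)} : Finset (Fin n × Fin n)).card = 2 := by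
    rw [card_pair]; simp [hne]
  rw [← h2, ← card_union_of_disjoint]
  · congr 1
    ext ⟨x, y⟩
    simp only [mem_union, mem_filter, mem_univ, true_and, addE_adj, mem_insert, mem_singleton,
      Prod.mk.injEq]
    constructor
    · rintro (h | ⟨rfl, rfl⟩ | ⟨rfl, rfl⟩)
      · by_cases h1 : x = a ∧ y = b
        · obtain ⟨rfl, rfl⟩ := h1
          tauto
        · by_cases h2 : x = b ∧ y = a
          · obtain ⟨rfl, rfl⟩ := h2
            tauto
          · tauto
      · tauto
      · tauto
    · intro h
      tauto
  · rw [Finset.disjoint_left]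
    rintro ⟨x, y⟩ h h'
    simp only [mem_filter, mem_univ, true_and, addE_adj, mem_insert, mem_singleton,
      Prod.mk.injEq] at h h'
    rcases h' with ⟨rfl, rfl⟩ | ⟨rfl, rfl⟩ <;> tauto

theorem graphDist_delE_add_two {n : ℕ} {A B : SimpleGraph (Fin n)} {a b : Fin n}
    (hA : A.Adj a b) (hB : ¬ B.Adj a b) : graphDist (delE A a b) B + 2 = graphDist A B := by
  classical
  have hne := hA.ne
  have hA' := hA.symm
  have hB' : ¬ B.Adj b a := fun h => hB h.symm
  rw [graphDist_eq_card, graphDist_eq_card]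
  have h2 : ({(a, b), (b, a)} : Finset (Fin n × Fin n)).card = 2 := by
    rw [card_pair]; simp [hne]
  rw [← h2, ← card_union_of_disjoint]
  · congr 1
    ext ⟨x, y⟩
    simp only [mem_union, mem_filter, mem_univ, true_and, delE_adj, mem_insert, mem_singleton,
      Prod.mk.injEq]
    constructor
    · rintro (h | ⟨rfl, rfl⟩ | ⟨rfl, rfl⟩)
      · by_cases h1 : x = a ∧ y = b
        · obtain ⟨rfl, rfl⟩ := h1
          tauto
        · by_cases h2 : x = b ∧ y = a
          · obtain ⟨rfl, rfl⟩ := h2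
            tauto
          · tauto
      · tauto
      · tauto
    · intro h
      tauto
  · rw [Finset.disjoint_left]
    rintro ⟨x, y⟩ h h'
    simp only [mem_filter, mem_univ, true_and, delE_adj, mem_insert, mem_singleton,
      Prod.mk.injEq] at h h'
    rcases h' with ⟨rfl, rfl⟩ | ⟨rfl, rfl⟩ <;> tauto

theorem graphDist_addE_self {n : ℕ} (A : SimpleGraph (Fin n)) (a b : Fin n) :
    graphDist (addE A a b) A ≤ 2 := by
  by_cases h : A.Adj a b ∨ a = b
  · have : addE A a b = A := by
      ext x y
      rw [addE_adj]
      constructor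
      · rintro (h1 | ⟨h0, ⟨rfl, rfl⟩ | ⟨rfl, rfl⟩⟩)
        · exact h1
        · tauto
        · exact (h.resolve_right h0).symm
      · exact Or.inl
    rw [this, graphDist_self]
    omega
  · push Not at h
    have := graphDist_addE_add_two (A := A) (B := addE A a b) h.1 (by rw [addE_adj]; tauto)
    rw [graphDist_self] at this
    rw [graphDist_comm]
    omega

theorem graphDist_delE_self {n : ℕ} (A : SimpleGraph (Fin n)) (a b : Fin n) :
    graphDist (delE A a b) A ≤ 2 := by
  by_cases h : A.Adj a b
  · have := graphDist_addE_self (delE A a b) a b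
    rw [addE_delE h] at this
    rwa [graphDist_comm]
  · have : delE A a b = A := by
      ext x y
      rw [delE_adj]
      constructor
      · exact fun h => h.1
      · intro h1
        refine ⟨h1, ?_⟩
        rintro (⟨rfl, rfl⟩ | ⟨rfl, rfl⟩)
        · exact h h1
        · exact h h1.symm
    rw [this, graphDist_self]
    omega

theorem graphDist_addE_le {n : ℕ} (A B : SimpleGraph (Fin n)) (a b : Fin n) :
    graphDist (addE A a b) B ≤ graphDist A B + 2 := by
  have h1 := graphDist_addE_self A a b
  have h2 := graphDist_triangle (addE A a b) A B
  omega

theorem graphDist_delE_le {n : ℕ} (A B : SimpleGraph (Fin n)) (a b : Fin n) :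
    graphDist (delE A a b) B ≤ graphDist A B + 2 := by
  have h1 := graphDist_delE_self A a b
  have h2 := graphDist_triangle (delE A a b) A B
  omega

/-- The two graphs are related by a switch, a hinge flip or an edge addition or deletion. -/
def Move {n : ℕ} (A B : SimpleGraph (Fin n)) : Prop :=
  1 ≤ switchCount A B + hingeCount A B + addDelCount A B

theorem move_delE {n : ℕ} {A : SimpleGraph (Fin n)} {a b : Fin n} (h : A.Adj a b) :
    Move A (delE A a b) := by
  have : 0 < addDelCount A (delE A a b) := by
    unfold addDelCount
    rw [Set.ncard_pos]
    refine ⟨(a, b), h.ne, ?_⟩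
    ext e
    induction e using Sym2.ind with
    | _ x y =>
      simp only [SimpleGraph.mem_edgeSet, delE_adj, Set.mem_symmDiff, Set.mem_singleton_iff,
        Sym2.eq_iff]
      have := h.symm
      constructor
      · tauto
      · rintro (h | ⟨⟨rfl, rfl⟩ | ⟨rfl, rfl⟩, h⟩) <;> tauto
  unfold Move
  omega

theorem move_hinge {n : ℕ} {A : SimpleGraph (Fin n)} {v w x : Fin n} (h1 : A.Adj v w)
    (h2 : ¬ A.Adj w x) (hne : w ≠ x) : Move A (addE (delE A v w) w x) := by
  have : 0 < hingeCount A (addE (delE A v w) w x) := by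
    unfold hingeCount
    rw [Set.ncard_pos]
    refine ⟨(v, w, x), h1, h2, ?_⟩
    ext e
    induction e using Sym2.ind with
    | _ p q =>
      simp only [SimpleGraph.mem_edgeSet, addE_adj, delE_adj, Set.mem_union, Set.mem_sdiff,
        Set.mem_singleton_iff, Sym2.eq_iff]
      tauto
  unfold Move
  omega

theorem move_switch {n : ℕ} {A : SimpleGraph (Fin n)} {v w x y : Fin n} (h1 : A.Adj v w)
    (h2 : A.Adj x y) (h3 : ¬ A.Adj v y) (h4 : ¬ A.Adj w x) (hvy : v ≠ y) (hwx : w ≠ x) :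
    Move A (addE (addE (delE (delE A v w) x y) v y) w x) := by
  have : 0 < switchCount A (addE (addE (delE (delE A v w) x y) v y) w x) := by
    unfold switchCount
    rw [Set.ncard_pos]
    refine ⟨(v, w, x, y), h1, h2, h3, h4, ?_⟩
    ext e
    induction e using Sym2.ind with
    | _ p q =>
      simp only [SimpleGraph.mem_edgeSet, addE_adj, delE_adj, Set.mem_union, Set.mem_sdiff,
        Set.mem_insert_iff, Set.mem_singleton_iff, Sym2.eq_iff, ne_eq, hvy, hwx,
        not_false_eq_true, true_and]
      generalize (p = v ∧ q = w ∨ p = w ∧ q = v) = P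
      generalize (p = x ∧ q = y ∨ p = y ∧ q = x) = Q
      generalize (p = v ∧ q = y ∨ p = y ∧ q = v) = R
      generalize (p = w ∧ q = x ∨ p = x ∧ q = w) = T
      tauto
  unfold Move
  omega

theorem degOf_hinge {n : ℕ} {A : SimpleGraph (Fin n)} {v w x : Fin n} (h1 : A.Adj v w)
    (h2 : ¬ A.Adj w x) (hne : w ≠ x) (i : Fin n) :
    degOf (addE (delE A v w) w x) i + (if i = v then 1 else 0) =
      degOf A i + (if i = x then 1 else 0) := by
  have e1 := degOf_delE h1 i
  have e2 := degOf_addE hne (show ¬ (delE A v w).Adj w x by rw [delE_adj]; tauto) i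
  omega

theorem degOf_switch {n : ℕ} {A : SimpleGraph (Fin n)} {v w x y : Fin n} (h1 : A.Adj v w)
    (h2 : A.Adj x y) (h3 : ¬ A.Adj v y) (h4 : ¬ A.Adj w x) (hvy : v ≠ y) (hwx : w ≠ x)
    (i : Fin n) :
    degOf (addE (addE (delE (delE A v w) x y) v y) w x) i = degOf A i := by
  have n1 := h1.ne
  have n2 := h2.ne
  have e1 := degOf_delE h1 i
  have e2 := degOf_delE (show (delE A v w).Adj x y by
    rw [delE_adj]
    refine ⟨h2, ?_⟩
    rintro (⟨rfl, rfl⟩ | ⟨rfl, rfl⟩) <;> tauto) i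
  have e3 := degOf_addE hvy (show ¬ (delE (delE A v w) x y).Adj v y by
    rw [delE_adj, delE_adj]; tauto) i
  have e4 := degOf_addE hwx (show ¬ (addE (delE (delE A v w) x y) v y).Adj w x by
    rw [addE_adj, delE_adj, delE_adj]
    rintro (h | ⟨-, ⟨rfl, rfl⟩ | ⟨rfl, rfl⟩⟩) <;> tauto) i
  omega

/-- One of the graphs can be moved, within the degree intervals, closer to the other. -/
def Reducible {n : ℕ} (ℓ u : Fin n → ℕ) (A B : SimpleGraph (Fin n)) : Prop :=
  (∃ A', memGlu n ℓ u A' ∧ Move A A' ∧ graphDist A' B < graphDist A B) ∨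
    (∃ B', memGlu n ℓ u B' ∧ Move B B' ∧ graphDist A B' < graphDist A B)

theorem Reducible.symm {n : ℕ} {ℓ u : Fin n → ℕ} {A B : SimpleGraph (Fin n)}
    (h : Reducible ℓ u A B) : Reducible ℓ u B A := by
  rcases h with ⟨A', h1, h2, h3⟩ | ⟨B', h1, h2, h3⟩
  · right
    exact ⟨A', h1, h2, by rwa [graphDist_comm B, graphDist_comm B]⟩
  · left
    exact ⟨B', h1, h2, by rwa [graphDist_comm _ A, graphDist_comm _ A]⟩

theorem reducible_of_switch {n : ℕ} {ℓ u : Fin n → ℕ} {A B : SimpleGraph (Fin n)}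
    (hA : memGlu n ℓ u A) (hB : memGlu n ℓ u B) {a b c d : Fin n}
    (hab : A.Adj a b) (hab' : ¬ B.Adj a b) (hbc : ¬ A.Adj b c) (hbc' : B.Adj b c)
    (hcd : A.Adj c d) (hcd' : ¬ B.Adj c d) (had : a ≠ d) (hch : ¬ (A.Adj a d ∧ ¬ B.Adj a d)) :
    Reducible ℓ u A B := by
  have n1 := hab.ne
  have n2 := hbc'.ne
  have n3 := hcd.ne
  have s1 := hab.symm
  have s3 := hcd.symm
  have s2 := hbc'.symm
  by_cases had' : A.Adj a d
  · have hadB : B.Adj a d := by tauto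
    have t4 := hadB.symm
    have t1 : ¬ B.Adj d c := fun h => hcd' h.symm
    right
    refine ⟨addE (addE (delE (delE B a d) c b) a b) d c, ?_,
      move_switch hadB s2 hab' t1 n1 n3.symm, ?_⟩
    · intro i
      rw [degOf_switch hadB s2 hab' t1 n1 n3.symm]
      exact hB i
    · rw [graphDist_comm A, graphDist_comm A]
      have e1 := graphDist_delE_le B A a d
      have e2 := graphDist_delE_add_two (A := delE B a d) (B := A) (a := c) (b := b)
        (by
          rw [delE_adj]
          refine ⟨s2, ?_⟩
          rintro (⟨rfl, rfl⟩ | ⟨rfl, rfl⟩) <;> tauto)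
        (fun h => hbc h.symm)
      have e3 := graphDist_addE_add_two (A := delE (delE B a d) c b) (B := A) (a := a) (b := b)
        (by rw [delE_adj, delE_adj]; tauto) hab
      have e4 := graphDist_addE_add_two (A := addE (delE (delE B a d) c b) a b) (B := A)
        (a := d) (b := c)
        (by
          rw [addE_adj, delE_adj, delE_adj]
          rintro (h | ⟨-, ⟨rfl, rfl⟩ | ⟨rfl, rfl⟩⟩) <;> tauto) s3
      omega
  · left
    refine ⟨addE (addE (delE (delE A a b) c d) a d) b c, ?_,
      move_switch hab hcd had' hbc had n2, ?_⟩
    · intro i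
      rw [degOf_switch hab hcd had' hbc had n2]
      exact hA i
    · have e1 := graphDist_delE_add_two hab hab'
      have e2 := graphDist_delE_add_two (A := delE A a b) (B := B) (a := c) (b := d)
        (by
          rw [delE_adj]
          refine ⟨hcd, ?_⟩
          rintro (⟨rfl, rfl⟩ | ⟨rfl, rfl⟩) <;> tauto) hcd'
      have e3 := graphDist_addE_le (delE (delE A a b) c d) B a d
      have e4 := graphDist_addE_add_two (A := addE (delE (delE A a b) c d) a d) (B := B)
        (a := b) (b := c)
        (by
          rw [addE_adj, delE_adj, delE_adj]
          rintro (h | ⟨-, ⟨rfl, rfl⟩ | ⟨rfl, rfl⟩⟩) <;> tauto) hbc'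
      omega

theorem reducible_of_hinge {n : ℕ} {ℓ u : Fin n → ℕ} {A B : SimpleGraph (Fin n)}
    (hA : memGlu n ℓ u A) {a b c : Fin n}
    (hab : A.Adj a b) (hab' : ¬ B.Adj a b) (hbc : ¬ A.Adj b c) (hbc' : B.Adj b c)
    (ha : ℓ a < degOf A a) (hc : degOf A c < u c) : Reducible ℓ u A B := by
  have n2 := hbc'.ne
  have hac : a ≠ c := by
    rintro rfl
    exact hbc hab.symm
  left
  refine ⟨addE (delE A a b) b c, ?_, move_hinge hab hbc n2, ?_⟩
  · intro i
    have e := degOf_hinge hab hbc n2 i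
    have hi := hA i
    by_cases h1 : i = a
    · subst h1
      simp only [if_true, if_neg hac] at e
      omega
    · by_cases h2 : i = c
      · subst h2
        simp only [if_true, if_neg h1] at e
        omega
      · simp only [if_neg h1, if_neg h2] at e
        omega
  · have e1 := graphDist_delE_add_two hab hab'
    have e2 := graphDist_addE_add_two (A := delE A a b) (B := B) (a := b) (b := c)
      (by rw [delE_adj]; tauto) hbc'
    omega

theorem reducible_of_delete {n : ℕ} {ℓ u : Fin n → ℕ} {A B : SimpleGraph (Fin n)}
    (hA : memGlu n ℓ u A) {a b : Fin n}
    (hab : A.Adj a b) (hab' : ¬ B.Adj a b)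
    (ha : ℓ a < degOf A a) (hb : ℓ b < degOf A b) : Reducible ℓ u A B := by
  have n1 := hab.ne
  left
  refine ⟨delE A a b, ?_, move_delE hab, ?_⟩
  · intro i
    have e := degOf_delE hab i
    have hi := hA i
    by_cases h1 : i = a
    · subst h1
      simp only [if_true, if_neg n1] at e
      omega
    · by_cases h2 : i = b
      · subst h2
        simp only [if_true, if_neg h1] at e
        omega
      · simp only [if_neg h1, if_neg h2] at e
        omega
  · have e1 := graphDist_delE_add_two hab hab'
    omega

open scoped Classical in
/-- The neighbours of `v` in `A` that are not neighbours of `v` in `B`. -/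
noncomputable def diffNbr {n : ℕ} (A B : SimpleGraph (Fin n)) (v : Fin n) : Finset (Fin n) :=
  univ.filter fun w => A.Adj v w ∧ ¬ B.Adj v w

theorem mem_diffNbr {n : ℕ} {A B : SimpleGraph (Fin n)} {v w : Fin n} :
    w ∈ diffNbr A B v ↔ A.Adj v w ∧ ¬ B.Adj v w := by
  classical
  simp [diffNbr]

theorem mem_diffNbr_symm {n : ℕ} {A B : SimpleGraph (Fin n)} {v w : Fin n} :
    w ∈ diffNbr A B v ↔ v ∈ diffNbr A B w := by
  rw [mem_diffNbr, mem_diffNbr, A.adj_comm, B.adj_comm]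

open scoped Classical in
theorem degOf_eq_card {n : ℕ} (A : SimpleGraph (Fin n)) (v : Fin n) :
    degOf A v = (univ.filter fun w => A.Adj v w).card := by
  unfold degOf
  rw [Set.ncard_eq_toFinset_card']
  congr 1
  ext w
  simp

theorem degOf_add_card_diffNbr {n : ℕ} (A B : SimpleGraph (Fin n)) (v : Fin n) :
    degOf A v + (diffNbr B A v).card = degOf B v + (diffNbr A B v).card := by
  classical
  have h1 : degOf A v = (univ.filter fun w => A.Adj v w ∧ B.Adj v w).card +
      (diffNbr A B v).card := by
    rw [degOf_eq_card, diffNbr, ← filter_filter, ← filter_filter,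
      card_filter_add_card_filter_not]
  have h2 : degOf B v = (univ.filter fun w => A.Adj v w ∧ B.Adj v w).card +
      (diffNbr B A v).card := by
    have : (univ.filter fun w => A.Adj v w ∧ B.Adj v w) =
        (univ.filter fun w => B.Adj v w ∧ A.Adj v w) := by
      ext w; simp [and_comm]
    rw [this, degOf_eq_card, diffNbr, ← filter_filter, ← filter_filter,
      card_filter_add_card_filter_not]
  omega

/-- If the edges `yx` and `xw` lie in `B \ A` and `A \ B`, and `y` has the most incident edges
of `A \ B`, then a switch brings the graphs closer. -/
theorem reducible_of_max {n : ℕ} {ℓ u : Fin n → ℕ} {A B : SimpleGraph (Fin n)}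
    (hA : memGlu n ℓ u A) (hB : memGlu n ℓ u B) {y x w : Fin n}
    (hmax : ∀ v, (diffNbr A B v).card ≤ (diffNbr A B y).card)
    (hyx : x ∈ diffNbr B A y) (hxw : w ∈ diffNbr A B x) : Reducible ℓ u A B := by
  by_contra hred
  rw [mem_diffNbr] at hyx
  have hxw' := mem_diffNbr_symm.1 hxw
  rw [mem_diffNbr] at hxw
  have key : ∀ z ∈ diffNbr A B y, z ≠ w → z ∈ diffNbr A B w := by
    intro z hz hzw
    rw [mem_diffNbr] at hz
    by_contra hzw'
    rw [mem_diffNbr] at hzw'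
    exact hred (reducible_of_switch hA hB (a := w) (b := x) (c := y) (d := z) hxw.1.symm
      (fun h => hxw.2 h.symm) (fun h => hyx.2 h.symm) hyx.1.symm hz.1 hz.2 hzw.symm hzw')
  have hxy : x ∉ diffNbr A B y := by
    rw [mem_diffNbr]; tauto
  by_cases hw : w ∈ diffNbr A B y
  · have hyw := mem_diffNbr_symm.1 hw
    have hyy : y ∉ diffNbr A B y := by simp [mem_diffNbr]
    have hsub : insert x (insert y ((diffNbr A B y).erase w)) ⊆ diffNbr A B w := by
      intro z hz
      simp only [mem_insert, mem_erase] at hz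
      rcases hz with rfl | rfl | hz
      · exact hxw'
      · exact hyw
      · exact key z hz.2 hz.1
    have hc := card_le_card hsub
    rw [card_insert_of_notMem, card_insert_of_notMem, card_erase_of_mem hw] at hc
    · have := hmax w
      have := card_pos.2 ⟨w, hw⟩
      omega
    · simp [hyy]
    · simp only [mem_insert, mem_erase, not_or]
      exact ⟨hyx.1.ne.symm, fun h => hxy h.2⟩
  · have hsub : insert x (diffNbr A B y) ⊆ diffNbr A B w := by
      intro z hz
      rw [mem_insert] at hz
      rcases hz with rfl | hz
      · exact hxw'
      · exact key z hz (fun h => hw (h ▸ hz))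
    have hc := card_le_card hsub
    rw [card_insert_of_notMem hxy] at hc
    have := hmax w
    omega

theorem reducible_of_max_both {n : ℕ} {ℓ u : Fin n → ℕ} (hlu : ∀ i, u i ≤ ℓ i + 1)
    {A B : SimpleGraph (Fin n)}
    (hA : memGlu n ℓ u A) (hB : memGlu n ℓ u B) {y : Fin n}
    (hmax : ∀ v, (diffNbr A B v).card ≤ (diffNbr A B y).card)
    (hr : (diffNbr A B y).Nonempty) (hb : (diffNbr B A y).Nonempty) : Reducible ℓ u A B := by
  by_contra hred
  obtain ⟨x, hx⟩ := hb
  obtain ⟨z, hz⟩ := hr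
  have hx0 : diffNbr A B x = ∅ := by
    rw [eq_empty_iff_forall_notMem]
    intro w hw
    exact hred (reducible_of_max hA hB hmax hx hw)
  have hdx := degOf_add_card_diffNbr A B x
  have hdz := degOf_add_card_diffNbr A B z
  have hx' := mem_diffNbr_symm.1 hx
  have hz' := mem_diffNbr_symm.1 hz
  have hxpos := card_pos.2 ⟨y, hx'⟩
  have hzpos := card_pos.2 ⟨y, hz'⟩
  rw [hx0, card_empty] at hdx
  rw [mem_diffNbr] at hx hz
  have := hA x
  have := hB x
  have := hlu x
  have := hA z
  have := hB z
  have := hlu z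
  have h1 : ¬ (ℓ z < degOf A z) := fun h =>
    hred (reducible_of_hinge hA (a := z) (b := y) (c := x) hz.1.symm (fun h => hz.2 h.symm)
      hx.2 hx.1 h (by omega))
  have h2 : ¬ (degOf B z < u z) := fun h =>
    hred (reducible_of_hinge hB (a := x) (b := y) (c := z) hx.1.symm (fun h => hx.2 h.symm)
      hz.2 hz.1 (by omega) h).symm
  obtain ⟨t, ht⟩ : (diffNbr B A z).Nonempty := by
    rw [← card_pos]; omega
  rw [mem_diffNbr] at ht
  have hty : t ≠ y := by
    rintro rfl
    exact hz.2 ht.1.symm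
  have hxt : x ≠ t := by
    rintro rfl
    have h3 : z ∈ diffNbr B A x := by
      rw [mem_diffNbr]; exact ⟨ht.1.symm, fun h => ht.2 h.symm⟩
    have h4 : z ≠ y := by
      rintro rfl
      exact hz.1.ne rfl
    have : ({z, y} : Finset (Fin n)) ⊆ diffNbr B A x := by
      intro q hq
      simp only [mem_insert, mem_singleton] at hq
      rcases hq with rfl | rfl
      · exact h3
      · exact hx'
    have := card_le_card this
    rw [card_pair h4] at this
    omega
  refine hred (reducible_of_switch hB hA (a := x) (b := y) (c := z) (d := t) hx.1.symm
    (fun h => hx.2 h.symm) hz.2 hz.1 ht.1 ht.2 hxt ?_).symm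
  intro hxt'
  have : ({t, y} : Finset (Fin n)) ⊆ diffNbr B A x := by
    intro q hq
    simp only [mem_insert, mem_singleton] at hq
    rcases hq with rfl | rfl
    · rwa [mem_diffNbr]
    · exact hx'
  have := card_le_card this
  rw [card_pair hty] at this
  omega

theorem reducible_of_diff {n : ℕ} {ℓ u : Fin n → ℕ} (hlu : ∀ i, u i ≤ ℓ i + 1)
    {A B : SimpleGraph (Fin n)} (hA : memGlu n ℓ u A) (hB : memGlu n ℓ u B) {a b : Fin n}
    (hab : A.Adj a b) (hab' : ¬ B.Adj a b) : Reducible ℓ u A B := by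
  by_contra hred
  obtain ⟨y, -, hmax⟩ := exists_max_image univ (fun v => (diffNbr A B v).card) ⟨a, mem_univ a⟩
  simp only [mem_univ, true_imp_iff] at hmax
  have hpos : 0 < (diffNbr A B y).card :=
    lt_of_lt_of_le (card_pos.2 ⟨b, mem_diffNbr.2 ⟨hab, hab'⟩⟩) (hmax a)
  have hb0 : (diffNbr B A y).card = 0 := by
    by_contra h
    exact hred (reducible_of_max_both hlu hA hB hmax (card_pos.1 hpos)
      (card_pos.1 (Nat.pos_of_ne_zero h)))
  have hdy := degOf_add_card_diffNbr A B y
  have := hA y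
  have := hB y
  have := hlu y
  have hone : (diffNbr A B y).card = 1 := by omega
  obtain ⟨z, hz⟩ := card_pos.1 hpos
  have hz' := card_pos.2 ⟨y, mem_diffNbr_symm.1 hz⟩
  rw [mem_diffNbr] at hz
  have hdz := degOf_add_card_diffNbr A B z
  have := hA z
  have := hB z
  have := hlu z
  have h1 : ¬ (ℓ z < degOf A z) := fun h =>
    hred (reducible_of_delete hA hz.1 hz.2 (by omega) h)
  obtain ⟨t, ht⟩ : (diffNbr B A z).Nonempty := by
    rw [← card_pos]; omega
  have ht' := card_pos.2 ⟨z, mem_diffNbr_symm.1 ht⟩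
  rw [mem_diffNbr] at ht
  have hdt := degOf_add_card_diffNbr A B t
  have := hA t
  have := hB t
  have := hlu t
  have h2 : ¬ (degOf A t < u t) := fun h =>
    hred (reducible_of_hinge hA (a := y) (b := z) (c := t) hz.1 hz.2 ht.2 ht.1 (by omega) h)
  have h3 : ¬ (ℓ t < degOf B t) := fun h =>
    hred (reducible_of_hinge hB (a := t) (b := z) (c := y) ht.1.symm (fun h => ht.2 h.symm)
      (fun h => hz.2 h.symm) hz.1.symm h (by omega)).symm
  have htpos : 0 < (diffNbr A B t).card := by omega
  refine hred (reducible_of_max_both hlu hA hB (y := t) ?_ (card_pos.1 htpos) (card_pos.1 ht'))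
  intro v
  have := hmax v
  omega

/-- For degree intervals of size at most one, distinct graphs can be brought closer together by
a move. -/
theorem reducible_of_ne {n : ℕ} {ℓ u : Fin n → ℕ} (hlu : ∀ i, u i ≤ ℓ i + 1)
    {A B : SimpleGraph (Fin n)} (hA : memGlu n ℓ u A) (hB : memGlu n ℓ u B) (hAB : A ≠ B) :
    Reducible ℓ u A B := by
  have : ∃ a b, ¬ (A.Adj a b ↔ B.Adj a b) := by
    by_contra! h
    exact hAB (by ext a b; exact h a b)
  obtain ⟨a, b, hab⟩ := this
  by_cases h : A.Adj a b
  · exact reducible_of_diff hlu hA hB h (by tauto)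
  · exact (reducible_of_diff hlu hB hA (a := a) (b := b) (by tauto) h).symm

open scoped Classical in
/-- The vertices other than `v` that are not adjacent to `v`. -/
noncomputable def nonNbr {n : ℕ} (G : SimpleGraph (Fin n)) (v : Fin n) : Finset (Fin n) :=
  univ.filter fun w => w ≠ v ∧ ¬ G.Adj v w

theorem mem_nonNbr {n : ℕ} {G : SimpleGraph (Fin n)} {v w : Fin n} :
    w ∈ nonNbr G v ↔ w ≠ v ∧ ¬ G.Adj v w := by
  classical
  simp [nonNbr]

theorem card_nonNbr {n : ℕ} (G : SimpleGraph (Fin n)) (v : Fin n) :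
    (nonNbr G v).card + degOf G v + 1 = n := by
  classical
  have h1 : (univ.filter fun w => ¬ G.Adj v w) = insert v (nonNbr G v) := by
    ext w
    simp only [mem_filter, mem_univ, true_and, mem_insert, mem_nonNbr]
    constructor
    · tauto
    · rintro (rfl | h)
      · exact G.loopless.irrefl w
      · exact h.2
  have h2 := card_filter_add_card_filter_not (s := (univ : Finset (Fin n))) (fun w => G.Adj v w)
  rw [← degOf_eq_card, h1, card_insert_of_notMem (by simp [mem_nonNbr]), card_univ,
    Fintype.card_fin] at h2
  omega

theorem even_sum_degOf {n : ℕ} (G : SimpleGraph (Fin n)) : Even (∑ v, degOf G v) := by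
  classical
  have : ∑ v, degOf G v = ∑ v, G.degree v := by
    refine sum_congr rfl fun v _ => ?_
    rw [degOf_eq_card, ← SimpleGraph.card_neighborFinset_eq_degree]
    congr 1
    ext w
    simp
  rw [this, SimpleGraph.sum_degrees_eq_twice_card_edges]
  exact even_two_mul _

/-- In a nearly regular dense graph, a long alternating path is available from `b`, once there is
no short one. -/
theorem exists_long_alternating {n : ℕ} {G : SimpleGraph (Fin n)} {L U : ℕ}
    (hL : ∀ v, L ≤ degOf G v) (hU : ∀ v, degOf G v ≤ U)
    (hc : n * (U - L + 1) < (n - 3 - U) * L) {a b : Fin n}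
    (hno : ∀ x ∈ nonNbr G a, ∀ y ∈ nonNbr G b, ¬ G.Adj x y) :
    ∃ x ∈ nonNbr G a, ∃ x' ∈ nonNbr G b, ∃ y' z, x' ≠ a ∧ x' ≠ x ∧ G.Adj x' y' ∧
      z ∈ nonNbr G y' ∧ G.Adj z x := by
  classical
  have hn : 3 + U < n := by
    by_contra h
    rw [show n - 3 - U = 0 by omega] at hc
    omega
  have hca := card_nonNbr G a
  have hUa := hU a
  have hcb := card_nonNbr G b
  have hUb := hU b
  obtain ⟨x, hx⟩ : (nonNbr G a).Nonempty := by
    rw [← card_pos]; omega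
  by_contra! hcon
  set B' := (nonNbr G b).erase a |>.erase x with hB'
  have hB'card : n - 3 - U ≤ B'.card := by
    have h1 := pred_card_le_card_erase (s := nonNbr G b) (a := a)
    have h2 := pred_card_le_card_erase (s := (nonNbr G b).erase a) (a := x)
    rw [hB']
    omega
  have hcx := card_nonNbr G x
  have hLx := hL x
  have hbound : ∀ y', (B'.filter fun x' => G.Adj x' y').card ≤ U - L + 1 := by
    intro y'
    by_cases hne : (B'.filter fun x' => G.Adj x' y').Nonempty
    · obtain ⟨x', hx'⟩ := hne
      rw [mem_filter] at hx'
      have hx'B := hx'.1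
      rw [hB', mem_erase, mem_erase] at hx'B
      have hsub : nonNbr G y' ⊆ insert x (nonNbr G x) := by
        intro z hz
        have := hcon x hx x' hx'B.2.2 y' z hx'B.2.1 hx'B.1 hx'.2 hz
        rw [mem_insert, mem_nonNbr]
        by_cases hzx : z = x
        · exact Or.inl hzx
        · exact Or.inr ⟨hzx, fun h => this h.symm⟩
      have hsub2 : (B'.filter fun x' => G.Adj x' y') ⊆ insert x (nonNbr G x) \ nonNbr G y' := by
        intro w hw
        rw [mem_filter, hB', mem_erase, mem_erase] at hw
        rw [mem_sdiff, mem_insert, mem_nonNbr, mem_nonNbr]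
        refine ⟨Or.inr ⟨hw.1.1, hno x hx w hw.1.2.2⟩, ?_⟩
        intro h
        exact h.2 hw.2.symm
      have h3 := card_le_card hsub2
      rw [card_sdiff_of_subset hsub, card_insert_of_notMem (by simp [mem_nonNbr])] at h3
      have := card_nonNbr G y'
      have := hU y'
      have := hL y'
      omega
    · rw [not_nonempty_iff_eq_empty] at hne
      rw [hne]
      simp
  have hdc := sum_card_bipartiteAbove_eq_sum_card_bipartiteBelow (s := B') (t := univ)
    (fun x y => G.Adj x y)
  have h1 : B'.card * L ≤ ∑ x' ∈ B', (bipartiteAbove (fun x y => G.Adj x y) univ x').card := by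
    rw [← smul_eq_mul]
    refine card_nsmul_le_sum _ _ _ fun x' _ => ?_
    have := hL x'
    rwa [degOf_eq_card] at this
  have h2 : ∑ y', (bipartiteBelow (fun x y => G.Adj x y) B' y').card ≤ n * (U - L + 1) := by
    have := sum_le_card_nsmul (univ : Finset (Fin n))
      (fun y' => (bipartiteBelow (fun x y => G.Adj x y) B' y').card) (U - L + 1)
      (fun y' _ => hbound y')
    simpa using this
  have h3 := Nat.mul_le_mul_right L hB'card
  omega

/-- In a sparse graph with few isolated vertices, a short alternating path is available. -/
theorem exists_short_alternating {n : ℕ} {G : SimpleGraph (Fin n)} {D U : ℕ}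
    {f : Fin n → ℕ} (hf : ∀ v, 1 ≤ degOf G v + f v) (hfD : ∑ v, f v ≤ D)
    (hU : ∀ v, degOf G v ≤ U)
    (hc : (U + 1) * U + U + 1 + D < n) (a b : Fin n) :
    ∃ x ∈ nonNbr G a, ∃ y ∈ nonNbr G b, G.Adj x y := by
  classical
  by_contra! hcon
  have hdc := sum_card_bipartiteAbove_eq_sum_card_bipartiteBelow (s := nonNbr G a)
    (t := (nonNbr G b)ᶜ) (fun x y => G.Adj x y)
  have h1 : (nonNbr G a).card ≤ ∑ x ∈ nonNbr G a,
      ((bipartiteAbove (fun x y => G.Adj x y) (nonNbr G b)ᶜ x).card + f x) := by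
    rw [card_eq_sum_ones]
    refine sum_le_sum fun x hx => ?_
    have h2 : bipartiteAbove (fun x y => G.Adj x y) (nonNbr G b)ᶜ x =
        univ.filter fun y => G.Adj x y := by
      ext y
      simp only [mem_bipartiteAbove, mem_compl, mem_filter, mem_univ, true_and,
        and_iff_right_iff_imp]
      exact fun h h' => hcon x hx y h' h
    rw [h2, ← degOf_eq_card]
    exact hf x
  rw [sum_add_distrib] at h1
  have h2 : ∑ x ∈ nonNbr G a, f x ≤ D :=
    (sum_le_sum_of_subset (subset_univ _)).trans hfD
  have h3 : ∑ y ∈ (nonNbr G b)ᶜ, (bipartiteBelow (fun x y => G.Adj x y) (nonNbr G a) y).card ≤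
      (nonNbr G b)ᶜ.card * U := by
    rw [← smul_eq_mul]
    refine sum_le_card_nsmul _ _ _ fun y _ => ?_
    refine le_trans ?_ (hU y)
    rw [degOf_eq_card]
    refine card_le_card fun x hx => ?_
    rw [mem_bipartiteBelow] at hx
    simpa using hx.2.symm
  have hca := card_nonNbr G a
  have hcb := card_nonNbr G b
  have hUa := hU a
  have hUb := hU b
  rw [card_compl, Fintype.card_fin] at h3
  have h4 : (n - (nonNbr G b).card) * U ≤ (U + 1) * U :=
    Nat.mul_le_mul_right U (by omega)
  omega

theorem exists_raise_of_short {n : ℕ} {G : SimpleGraph (Fin n)} {a b x y : Fin n}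
    (hx : x ∈ nonNbr G a) (hy : y ∈ nonNbr G b) (hxy : G.Adj x y) :
    ∃ G' : SimpleGraph (Fin n), (∀ v, degOf G' v =
      degOf G v + (if v = a then 1 else 0) + (if v = b then 1 else 0)) ∧
      graphDist G' G ≤ 10 := by
  rw [mem_nonNbr] at hx hy
  have hne := hxy.ne
  have hyx := hxy.symm
  refine ⟨addE (addE (delE G x y) a x) b y, ?_, ?_⟩
  · intro v
    have e1 := degOf_delE hxy v
    have e2 := degOf_addE hx.1.symm (show ¬ (delE G x y).Adj a x by rw [delE_adj]; tauto) v
    have e3 := degOf_addE hy.1.symm (show ¬ (addE (delE G x y) a x).Adj b y by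
      rw [addE_adj, delE_adj]
      rintro (h | ⟨-, ⟨rfl, rfl⟩ | ⟨rfl, rfl⟩⟩) <;> tauto) v
    omega
  · have e1 := graphDist_delE_self G x y
    have e2 := graphDist_addE_le (delE G x y) G a x
    have e3 := graphDist_addE_le (addE (delE G x y) a x) G b y
    omega

theorem exists_raise_of_long {n : ℕ} {G : SimpleGraph (Fin n)} {a b x x' y' z : Fin n}
    (hno : ∀ x ∈ nonNbr G a, ∀ y ∈ nonNbr G b, ¬ G.Adj x y)
    (hx : x ∈ nonNbr G a) (hx' : x' ∈ nonNbr G b) (hxa : x' ≠ a) (hxx : x' ≠ x)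
    (hxy : G.Adj x' y') (hz : z ∈ nonNbr G y') (hzx : G.Adj z x) :
    ∃ G' : SimpleGraph (Fin n), (∀ v, degOf G' v =
      degOf G v + (if v = a then 1 else 0) + (if v = b then 1 else 0)) ∧
      graphDist G' G ≤ 10 := by
  have hnot := hno x hx x' hx'
  rw [mem_nonNbr] at hx hx' hz
  have hne1 := hxy.ne
  have hne2 := hzx.ne
  have hyx := hxy.symm
  have hxz := hzx.symm
  have hnot' : ¬ G.Adj x' x := fun h => hnot h.symm
  have hx2 : ¬ G.Adj x a := fun h => hx.2 h.symm
  have hz2 : ¬ G.Adj z y' := fun h => hz.2 h.symm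
  have hx2' : ¬ G.Adj x' b := fun h => hx'.2 h.symm
  refine ⟨addE (addE (addE (delE (delE G x' y') z x) b x') y' z) x a, ?_, ?_⟩
  · intro v
    have e1 := degOf_delE hxy v
    have e2 := degOf_delE (show (delE G x' y').Adj z x by
      rw [delE_adj]
      refine ⟨hzx, ?_⟩
      rintro (⟨rfl, rfl⟩ | ⟨rfl, rfl⟩) <;> tauto) v
    have e3 := degOf_addE hx'.1.symm (show ¬ (delE (delE G x' y') z x).Adj b x' by
      rw [delE_adj, delE_adj]; tauto) v
    have e4 := degOf_addE hz.1.symm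
      (show ¬ (addE (delE (delE G x' y') z x) b x').Adj y' z by
        rw [addE_adj, delE_adj, delE_adj]
        rintro (h | ⟨-, ⟨rfl, rfl⟩ | ⟨rfl, rfl⟩⟩) <;> tauto) v
    have e5 := degOf_addE hx.1
      (show ¬ (addE (addE (delE (delE G x' y') z x) b x') y' z).Adj x a by
        rw [addE_adj, addE_adj, delE_adj, delE_adj]
        rintro ((h | ⟨-, ⟨rfl, rfl⟩ | ⟨rfl, rfl⟩⟩) | ⟨-, ⟨rfl, rfl⟩ | ⟨rfl, rfl⟩⟩) <;> tauto) v
    omega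
  · have e1 := graphDist_delE_self G x' y'
    have e2 := graphDist_delE_le (delE G x' y') G z x
    have e3 := graphDist_addE_le (delE (delE G x' y') z x) G b x'
    have e4 := graphDist_addE_le (addE (delE (delE G x' y') z x) b x') G y' z
    have e5 := graphDist_addE_le (addE (addE (delE (delE G x' y') z x) b x') y' z) G x a
    omega

/-- How far the degrees are from the target `d`; excesses count twice. -/
noncomputable def degDefect {n : ℕ} (G : SimpleGraph (Fin n)) (d : Fin n → ℕ) : ℕ :=
  ∑ v, (2 * (degOf G v - d v) + (d v - degOf G v))

/-- The numerical conditions on degree bounds `L, U` under which `D` defects can be repaired. -/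
def RepairCond (n L U D : ℕ) : Prop :=
  n * (U - L + 1) < (n - 3 - U) * L ∨ (U + 1) * U + U + 1 + D < n

theorem exists_degDefect_lt {n L U D : ℕ} (hc : RepairCond n L U D)
    {G : SimpleGraph (Fin n)} {d : Fin n → ℕ} (hd1 : ∀ v, 1 ≤ d v) (hdL : ∀ v, L ≤ d v - D)
    (hdU : ∀ v, d v ≤ U) (heven : Even (∑ v, d v)) (hD : degDefect G d ≤ D)
    (hpos : 0 < degDefect G d) :
    ∃ G' : SimpleGraph (Fin n), degDefect G' d < degDefect G d ∧ graphDist G' G ≤ 10 := by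
  classical
  by_cases hex : ∃ v, d v < degOf G v
  · obtain ⟨v, hv⟩ := hex
    obtain ⟨w, hw⟩ : ∃ w, G.Adj v w := by
      have : 0 < degOf G v := by omega
      rw [degOf_eq_card, card_pos] at this
      obtain ⟨w, hw⟩ := this
      exact ⟨w, by simpa using hw⟩
    refine ⟨delE G v w, ?_, (graphDist_delE_self G v w).trans (by norm_num)⟩
    have hsum : degDefect (delE G v w) d + 2 ≤ degDefect G d + 1 := by
      have h1 : ∑ i, ((2 * (degOf (delE G v w) i - d i) + (d i - degOf (delE G v w) i)) +
          (if i = v then 2 else 0)) ≤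
          ∑ i, ((2 * (degOf G i - d i) + (d i - degOf G i)) + (if i = w then 1 else 0)) := by
        refine sum_le_sum fun i _ => ?_
        have e := degOf_delE hw i
        have := hw.ne
        by_cases h1 : i = v
        · subst h1
          simp only [if_true, if_neg this] at e ⊢
          omega
        · by_cases h2 : i = w
          · subst h2
            simp only [if_true, if_neg h1] at e ⊢
            omega
          · simp only [if_neg h1, if_neg h2] at e ⊢
            omega
      rw [sum_add_distrib (g := fun i => if i = v then 2 else 0),
        sum_add_distrib (g := fun i => if i = w then 1 else 0), sum_ite_eq' univ v (fun _ => 2),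
        sum_ite_eq' univ w (fun _ => 1), if_pos (mem_univ v), if_pos (mem_univ w)] at h1
      exact h1
    omega
  · push Not at hex
    have hM : ∑ v, d v = degDefect G d + ∑ v, degOf G v := by
      unfold degDefect
      rw [← sum_add_distrib]
      refine sum_congr rfl fun v _ => ?_
      have := hex v
      omega
    have hevenM : Even (degDefect G d) := by
      have := even_sum_degOf G
      rw [hM, Nat.even_add] at heven
      exact heven.2 this
    have hterm : ∀ v, d v ≤ degOf G v + D := by
      intro v
      have : 2 * (degOf G v - d v) + (d v - degOf G v) ≤ degDefect G d :=
        single_le_sum (f := fun v => 2 * (degOf G v - d v) + (d v - degOf G v))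
          (fun _ _ => Nat.zero_le _) (mem_univ v)
      omega
    obtain ⟨a, ha⟩ : ∃ a, degOf G a < d a := by
      by_contra! h
      have : degDefect G d = 0 := by
        unfold degDefect
        refine sum_eq_zero fun v _ => ?_
        have := hex v
        have := h v
        omega
      omega
    obtain ⟨b, hb, hab⟩ : ∃ b, degOf G b < d b ∧ (a = b → degOf G a + 2 ≤ d a) := by
      by_cases h2 : degOf G a + 2 ≤ d a
      · exact ⟨a, ha, fun _ => h2⟩
      · by_contra! h
        have hone : degDefect G d = 1 := by
          have hall : ∀ v, 2 * (degOf G v - d v) + (d v - degOf G v) = if v = a then 1 else 0 := by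
            intro v
            have := hex v
            split_ifs with hva
            · subst hva
              omega
            · by_contra hne
              have := (h v (by omega)).1
              exact hva this.symm
          unfold degDefect
          rw [sum_congr rfl fun v _ => hall v]
          simp
        rw [hone] at hevenM
        exact absurd hevenM (by decide)
    obtain ⟨G', hG', hdist⟩ : ∃ G' : SimpleGraph (Fin n), (∀ v, degOf G' v =
        degOf G v + (if v = a then 1 else 0) + (if v = b then 1 else 0)) ∧
        graphDist G' G ≤ 10 := by
      by_cases hsh : ∃ x ∈ nonNbr G a, ∃ y ∈ nonNbr G b, G.Adj x y
      · obtain ⟨x, hx, y, hy, hxy⟩ := hsh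
        exact exists_raise_of_short hx hy hxy
      · rcases hc with hc | hc
        · push Not at hsh
          obtain ⟨x, hx, x', hx', y', z, h1, h2, h3, h4, h5⟩ :=
            exists_long_alternating (G := G) (L := L) (U := U)
              (fun v => by have := hdL v; have := hterm v; omega)
              (fun v => (hex v).trans (hdU v)) hc hsh
          exact exists_raise_of_long hsh hx hx' h1 h2 h3 h4 h5
        · exfalso
          refine hsh (exists_short_alternating (D := D) (f := fun v => d v - degOf G v) ?_ ?_
            (fun v => (hex v).trans (hdU v)) hc a b)
          · intro v
            have := hd1 v
            omega
          · refine le_trans (sum_le_sum fun v _ => ?_) hD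
            omega
    refine ⟨G', ?_, hdist⟩
    have hsum : degDefect G' d < degDefect G d := by
      unfold degDefect
      refine sum_lt_sum (fun i _ => ?_) ⟨a, mem_univ a, ?_⟩
      · have e := hG' i
        have := hex i
        by_cases h1 : i = a
        · subst h1
          by_cases h2 : i = b
          · subst h2
            have := hab rfl
            simp only [if_true] at e
            omega
          · simp only [if_true, if_neg h2] at e
            omega
        · by_cases h2 : i = b
          · subst h2
            simp only [if_true, if_neg h1] at e
            omega
          · simp only [if_neg h1, if_neg h2] at e
            omega
      · have e := hG' a
        have := hex a
        by_cases h2 : a = b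
        · have := hab h2
          simp only [if_true, if_pos h2] at e
          omega
        · simp only [if_true, if_neg h2] at e
          omega
    exact hsum

theorem exists_repair_to {n L U D : ℕ} (hc : RepairCond n L U D)
    {d : Fin n → ℕ} (hd1 : ∀ v, 1 ≤ d v) (hdL : ∀ v, L ≤ d v - D)
    (hdU : ∀ v, d v ≤ U) (heven : Even (∑ v, d v)) (m : ℕ) :
    ∀ G : SimpleGraph (Fin n), degDefect G d ≤ m → m ≤ D →
      ∃ G' : SimpleGraph (Fin n), (∀ v, degOf G' v = d v) ∧ graphDist G' G ≤ 10 * m := by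
  induction m with
  | zero =>
    intro G hG _
    refine ⟨G, fun v => ?_, by simp [graphDist_self]⟩
    have h0 : degDefect G d = 0 := by omega
    unfold degDefect at h0
    rw [sum_eq_zero_iff] at h0
    have := h0 v (mem_univ v)
    omega
  | succ m ih =>
    intro G hG hm
    by_cases hpos : 0 < degDefect G d
    · obtain ⟨G₁, h1, h2⟩ := exists_degDefect_lt hc hd1 hdL hdU heven (hG.trans hm) hpos
      obtain ⟨G₂, h3, h4⟩ := ih G₁ (by omega) (by omega)
      refine ⟨G₂, h3, ?_⟩
      have := graphDist_triangle G₂ G₁ G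
      omega
    · obtain ⟨G₂, h3, h4⟩ := ih G (by omega) (by omega)
      exact ⟨G₂, h3, by omega⟩

/-- A graph whose degrees violate the intervals only slightly is close to a graph satisfying
them. -/
theorem exists_repair {n L U D : ℕ} (hc : RepairCond n L U (2 * (D + 1)))
    {ℓ u : Fin n → ℕ} (hlu : ∀ i, ℓ i ≤ u i ∧ u i ≤ ℓ i + 1)
    (hl1 : ∀ v, 1 ≤ ℓ v) (hlL : ∀ v, L ≤ ℓ v - 2 * (D + 1)) (huU : ∀ v, u v ≤ U)
    {G₀ : SimpleGraph (Fin n)} (hG₀ : memGlu n ℓ u G₀) {G : SimpleGraph (Fin n)} {b : Fin n → ℕ}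
    (h1 : ∀ v, ℓ v ≤ degOf G v + b v) (h2 : ∀ v, degOf G v ≤ u v + b v) (hb : ∑ v, b v ≤ D) :
    ∃ G' : SimpleGraph (Fin n), memGlu n ℓ u G' ∧ graphDist G' G ≤ 20 * (D + 1) := by
  classical
  obtain ⟨d, hdl, hdu, heven, hdef⟩ : ∃ d : Fin n → ℕ, (∀ v, ℓ v ≤ d v) ∧ (∀ v, d v ≤ u v) ∧
      Even (∑ v, d v) ∧ degDefect G d ≤ 2 * (D + 1) := by
    have hcl : ∀ v, ∃ c, ℓ v ≤ c ∧ c ≤ u v ∧ degOf G v ≤ c + b v ∧ c ≤ degOf G v + b v := by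
      intro v
      have := h1 v
      have := h2 v
      have := hlu v
      by_cases h : degOf G v < ℓ v
      · exact ⟨ℓ v, by omega⟩
      · by_cases h' : u v < degOf G v
        · exact ⟨u v, by omega⟩
        · exact ⟨degOf G v, by omega⟩
    choose c hc1 hc2 hc3 hc4 using hcl
    have hgen : ∀ (d e : Fin n → ℕ), (∀ v, degOf G v ≤ d v + (b v + e v)) →
        (∀ v, d v ≤ degOf G v + (b v + e v)) → ∑ v, e v ≤ 1 →
        degDefect G d ≤ 2 * (D + 1) := by
      intro d e h3 h4 h5
      have : degDefect G d ≤ ∑ v, 2 * (b v + e v) := by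
        refine sum_le_sum fun v _ => ?_
        have := h3 v
        have := h4 v
        omega
      rw [← mul_sum, sum_add_distrib] at this
      omega
    by_cases hev : Even (∑ v, c v)
    · exact ⟨c, hc1, hc2, hev, hgen c 0 (fun v => by simpa using hc3 v)
        (fun v => by simpa using hc4 v) (by simp)⟩
    · obtain ⟨v, hv⟩ : ∃ v, c v ≠ degOf G₀ v := by
        by_contra! h
        rw [sum_congr rfl fun v _ => h v] at hev
        exact hev (even_sum_degOf G₀)
      have hv1 := hc1 v
      have hv2 := hc2 v
      have hv3 := hG₀ v
      have hv4 := hlu v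
      have hsum : ∑ w, Function.update c v (degOf G₀ v) w + c v = ∑ w, c w + degOf G₀ v := by
        have e1 := add_sum_erase univ c (mem_univ v)
        have e2 := add_sum_erase univ (Function.update c v (degOf G₀ v)) (mem_univ v)
        have e3 : ∑ w ∈ univ.erase v, Function.update c v (degOf G₀ v) w =
            ∑ w ∈ univ.erase v, c w := by
          refine sum_congr rfl fun w hw => ?_
          rw [Function.update_of_ne (ne_of_mem_erase hw)]
        rw [Function.update_self] at e2
        omega
      refine ⟨Function.update c v (degOf G₀ v), ?_, ?_, ?_,
        hgen _ (fun w => if w = v then 1 else 0) ?_ ?_ (by simp)⟩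
      · intro w
        by_cases h : w = v
        · subst h; simpa using hv3.1
        · simpa [h] using hc1 w
      · intro w
        by_cases h : w = v
        · subst h; simpa using hv3.2
        · simpa [h] using hc2 w
      · rw [Nat.not_even_iff_odd, Nat.odd_iff] at hev
        rw [Nat.even_iff]
        omega
      · intro w
        have := hc3 w
        by_cases h : w = v
        · subst h
          simp only [Function.update_self, if_true]
          omega
        · simpa [h] using this
      · intro w
        have := hc4 w
        by_cases h : w = v
        · subst h
          simp only [Function.update_self, if_true]
          omega
        · simpa [h] using this
  obtain ⟨G', hG', hdist⟩ := exists_repair_to hc (fun v => (hl1 v).trans (hdl v))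
    (fun v => by have := hlL v; have := hdl v; omega) (fun v => (hdu v).trans (huU v)) heven
    (2 * (D + 1)) G hdef le_rfl
  refine ⟨G', fun v => ?_, by omega⟩
  rw [hG' v]
  exact ⟨hdl v, hdu v⟩

/-- Nodes of the matching gadget: a port `(v, some w)` for every ordered pair, a dummy port
`(v, none)` for every vertex, and `n - 1 - ℓ v` fillers for every vertex `v`. -/
abbrev Node (n : ℕ) (ℓ : Fin n → ℕ) : Type :=
  (Fin n × Option (Fin n)) ⊕ (Σ v : Fin n, Fin (n - 1 - ℓ v))

/-- The vertex to which a node belongs. -/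
def Node.owner {n : ℕ} {ℓ : Fin n → ℕ} : Node n ℓ → Fin n
  | Sum.inl p => p.1
  | Sum.inr q => q.1

/-- The port opposite to a given one. -/
def oppPort {n : ℕ} (v : Fin n) : Option (Fin n) → Fin n × Option (Fin n)
  | none => (v, none)
  | some w => (w, some v)

open scoped Classical in
/-- The ports at `v` that have to be matched to fillers when the graph is `G`. -/
noncomputable def freePorts {n : ℕ} (ℓ : Fin n → ℕ) (G : SimpleGraph (Fin n)) (v : Fin n) :
    Finset (Option (Fin n)) :=
  univ.filter fun o => o.elim (ℓ v < degOf G v) (fun w => w ∈ nonNbr G v)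

theorem some_mem_freePorts {n : ℕ} {ℓ : Fin n → ℕ} {G : SimpleGraph (Fin n)} {v w : Fin n} :
    some w ∈ freePorts ℓ G v ↔ w ∈ nonNbr G v := by
  classical
  simp [freePorts]

theorem none_mem_freePorts {n : ℕ} {ℓ : Fin n → ℕ} {G : SimpleGraph (Fin n)} {v : Fin n} :
    none ∈ freePorts ℓ G v ↔ ℓ v < degOf G v := by
  classical
  simp [freePorts]

theorem card_freePorts {n : ℕ} {ℓ u : Fin n → ℕ} (hlu : ∀ i, u i ≤ ℓ i + 1)
    {G : SimpleGraph (Fin n)} (hG : memGlu n ℓ u G) (v : Fin n) :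
    (freePorts ℓ G v).card = n - 1 - ℓ v := by
  classical
  have h1 := card_nonNbr G v
  have h2 := hG v
  have h3 := hlu v
  by_cases h : ℓ v < degOf G v
  · have : freePorts ℓ G v = insertNone (nonNbr G v) := by
      ext o
      cases o with
      | none => simp [none_mem_freePorts, h]
      | some w => simp [some_mem_freePorts]
    rw [this, card_insertNone]
    omega
  · have : freePorts ℓ G v = (nonNbr G v).map Function.Embedding.some := by
      ext o
      cases o with
      | none => simp [none_mem_freePorts, h]
      | some w => simp [some_mem_freePorts]
    rw [this, card_map]
    omega

open scoped Classical in
/-- The perfect matching of the gadget given by a graph and, at every vertex, a bijection from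
fillers to free ports. -/
noncomputable def liftFun {n : ℕ} {ℓ : Fin n → ℕ} (G : SimpleGraph (Fin n))
    (e : ∀ v, Fin (n - 1 - ℓ v) ≃ freePorts ℓ G v) : Node n ℓ → Node n ℓ
  | Sum.inl (v, o) =>
    if h : o ∈ freePorts ℓ G v then Sum.inr ⟨v, (e v).symm ⟨o, h⟩⟩ else Sum.inl (oppPort v o)
  | Sum.inr ⟨v, j⟩ => Sum.inl (v, (e v j).1)

section liftFun

variable {n : ℕ} {ℓ : Fin n → ℕ} {G : SimpleGraph (Fin n)}
  {e : ∀ v, Fin (n - 1 - ℓ v) ≃ freePorts ℓ G v}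

theorem liftFun_filler (v : Fin n) (j : Fin (n - 1 - ℓ v)) :
    liftFun G e (Sum.inr ⟨v, j⟩) = Sum.inl (v, (e v j).1) := rfl

theorem liftFun_of_mem {v : Fin n} {o : Option (Fin n)} (h : o ∈ freePorts ℓ G v) :
    liftFun G e (Sum.inl (v, o)) = Sum.inr ⟨v, (e v).symm ⟨o, h⟩⟩ := by
  simp [liftFun, h]

theorem liftFun_of_notMem {v : Fin n} {o : Option (Fin n)} (h : o ∉ freePorts ℓ G v) :
    liftFun G e (Sum.inl (v, o)) = Sum.inl (oppPort v o) := by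
  simp [liftFun, h]

theorem liftFun_of_apply {v : Fin n} {o : Option (Fin n)} {j : Fin (n - 1 - ℓ v)}
    (h : (e v j).1 = o) : liftFun G e (Sum.inl (v, o)) = Sum.inr ⟨v, j⟩ := by
  subst h
  rw [liftFun_of_mem (e v j).2]
  simp

theorem liftFun_liftFun (x : Node n ℓ) : liftFun G e (liftFun G e x) = x := by
  rcases x with ⟨v, o⟩ | ⟨v, j⟩
  · by_cases h : o ∈ freePorts ℓ G v
    · rw [liftFun_of_mem h, liftFun_filler]
      simp
    · rw [liftFun_of_notMem h]
      cases o with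
      | none => exact liftFun_of_notMem h
      | some w =>
        have h' : some v ∉ freePorts ℓ G w := by
          rw [some_mem_freePorts, mem_nonNbr] at h ⊢
          rw [G.adj_comm, ne_comm]
          exact h
        exact liftFun_of_notMem h'
  · rw [liftFun_filler]
    exact liftFun_of_apply rfl

theorem liftFun_eq_inl_iff {v w : Fin n} (hvw : v ≠ w) :
    liftFun G e (Sum.inl (v, some w)) = Sum.inl (w, some v) ↔ G.Adj v w := by
  constructor
  · intro h
    by_contra h'
    rw [liftFun_of_mem (some_mem_freePorts.2 (mem_nonNbr.2 ⟨hvw.symm, h'⟩))] at h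
    exact Sum.inr_ne_inl h
  · intro h
    exact liftFun_of_notMem (by rw [some_mem_freePorts, mem_nonNbr]; tauto)

end liftFun

/-- The graphs with degrees in the given intervals. -/
abbrev IntervalGraph (n : ℕ) (ℓ u : Fin n → ℕ) : Type :=
  {G : SimpleGraph (Fin n) // memGlu n ℓ u G}

/-- A graph with degrees in the intervals together with a perfect matching of the gadget. -/
abbrev Lifted (n : ℕ) (ℓ u : Fin n → ℕ) : Type :=
  Σ G : IntervalGraph n ℓ u, ∀ v, Fin (n - 1 - ℓ v) ≃ freePorts ℓ G.1 v

/-- The involution of the gadget corresponding to a lifted graph. -/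
noncomputable def Lifted.toFun {n : ℕ} {ℓ u : Fin n → ℕ} (i : Lifted n ℓ u) :
    Node n ℓ → Node n ℓ :=
  liftFun i.1.1 i.2

theorem Lifted.toFun_injective {n : ℕ} {ℓ u : Fin n → ℕ} :
    Function.Injective (Lifted.toFun (n := n) (ℓ := ℓ) (u := u)) := by
  rintro ⟨⟨G, hG⟩, e⟩ ⟨⟨G', hG'⟩, e'⟩ h
  change liftFun G e = liftFun G' e' at h
  have hGG : G = G' := by
    ext v w
    by_cases hvw : v = w
    · subst hvw
      simp
    · rw [← liftFun_eq_inl_iff (e := e) hvw, h, liftFun_eq_inl_iff (e := e') hvw]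
  subst hGG
  have hee : e = e' := by
    funext v
    ext j : 2
    have := congrFun h (Sum.inr ⟨v, j⟩)
    rw [liftFun_filler, liftFun_filler] at this
    exact (Prod.mk.inj (Sum.inl.inj this)).2
  rw [hee]

/-- The local constraints satisfied by matchings of the gadget. -/
def AllowedFun {n : ℕ} {ℓ : Fin n → ℕ} (u : Fin n → ℕ) (Z : Node n ℓ → Node n ℓ) : Prop :=
  (∀ v j, ∃ o, o ≠ some v ∧ (o = none → ℓ v < u v) ∧ Z (Sum.inr ⟨v, j⟩) = Sum.inl (v, o)) ∧
    (∀ v o, Z (Sum.inl (v, o)) = Sum.inl (oppPort v o) ∨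
      ∃ j, Z (Sum.inl (v, o)) = Sum.inr ⟨v, j⟩)

theorem Lifted.allowedFun {n : ℕ} {ℓ u : Fin n → ℕ} (i : Lifted n ℓ u) :
    AllowedFun u i.toFun := by
  refine ⟨fun v j => ⟨(i.2 v j).1, ?_, ?_, rfl⟩, fun v o => ?_⟩
  · intro h
    have := (i.2 v j).2
    rw [h, some_mem_freePorts, mem_nonNbr] at this
    exact this.1 rfl
  · intro h
    have := (i.2 v j).2
    rw [h, none_mem_freePorts] at this
    exact lt_of_lt_of_le this (i.1.2 v).2
  · by_cases h : o ∈ freePorts ℓ i.1.1 v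
    · right
      exact ⟨_, liftFun_of_mem h⟩
    · left
      exact liftFun_of_notMem h

open scoped Classical in
/-- The nodes at which `Z` fails to be an involution. -/
noncomputable def badNodes {n : ℕ} {ℓ : Fin n → ℕ} (Z : Node n ℓ → Node n ℓ) :
    Finset (Node n ℓ) :=
  univ.filter fun x => Z (Z x) ≠ x

theorem mem_badNodes {n : ℕ} {ℓ : Fin n → ℕ} {Z : Node n ℓ → Node n ℓ} {x : Node n ℓ} :
    x ∈ badNodes Z ↔ Z (Z x) ≠ x := by
  classical
  simp [badNodes]

/-- The graph of the pairs of opposite ports matched by `Z`. -/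
def graphOf {n : ℕ} {ℓ : Fin n → ℕ} (Z : Node n ℓ → Node n ℓ) : SimpleGraph (Fin n) where
  Adj v w := v ≠ w ∧ Z (Sum.inl (v, some w)) = Sum.inl (w, some v) ∧
    Z (Sum.inl (w, some v)) = Sum.inl (v, some w)
  symm := ⟨fun _ _ h => ⟨h.1.symm, h.2.2, h.2.1⟩⟩
  loopless := ⟨fun _ h => h.1 rfl⟩

theorem graphOf_adj {n : ℕ} {ℓ : Fin n → ℕ} {Z : Node n ℓ → Node n ℓ} {v w : Fin n} :
    (graphOf Z).Adj v w ↔ v ≠ w ∧ Z (Sum.inl (v, some w)) = Sum.inl (w, some v) ∧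
      Z (Sum.inl (w, some v)) = Sum.inl (v, some w) := Iff.rfl

open scoped Classical in
/-- The ports at `v` that `Z` properly matches to fillers. -/
noncomputable def matchedPorts {n : ℕ} {ℓ : Fin n → ℕ} (Z : Node n ℓ → Node n ℓ) (v : Fin n) :
    Finset (Option (Fin n)) :=
  univ.filter fun o => ∃ j, Z (Sum.inl (v, o)) = Sum.inr ⟨v, j⟩ ∧
    Z (Sum.inr ⟨v, j⟩) = Sum.inl (v, o)

theorem mem_matchedPorts {n : ℕ} {ℓ : Fin n → ℕ} {Z : Node n ℓ → Node n ℓ} {v : Fin n}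
    {o : Option (Fin n)} : o ∈ matchedPorts Z v ↔ ∃ j, Z (Sum.inl (v, o)) = Sum.inr ⟨v, j⟩ ∧
    Z (Sum.inr ⟨v, j⟩) = Sum.inl (v, o) := by
  classical
  simp [matchedPorts]

section near

variable {n : ℕ} {ℓ u : Fin n → ℕ} {Z : Node n ℓ → Node n ℓ}

theorem AllowedFun.mem_nonNbr_of_some_mem (hZ : AllowedFun u Z) {v w : Fin n}
    (h : some w ∈ matchedPorts Z v) : w ∈ nonNbr (graphOf Z) v := by
  obtain ⟨j, h1, h2⟩ := mem_matchedPorts.1 h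
  rw [mem_nonNbr, graphOf_adj, h1]
  refine ⟨?_, fun h => Sum.inr_ne_inl h.2.1⟩
  rintro rfl
  obtain ⟨o, ho, -, h3⟩ := hZ.1 w j
  rw [h2] at h3
  exact ho (Prod.mk.inj (Sum.inl.inj h3)).2.symm

theorem AllowedFun.some_mem_of_mem_nonNbr (hZ : AllowedFun u Z) {v w : Fin n}
    (h : w ∈ nonNbr (graphOf Z) v) (hb : (Sum.inl (v, some w) : Node n ℓ) ∉ badNodes Z) :
    some w ∈ matchedPorts Z v := by
  rw [mem_badNodes, not_not] at hb
  rw [mem_nonNbr, graphOf_adj] at h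
  rcases hZ.2 v (some w) with h1 | ⟨j, h1⟩
  · rw [h1] at hb
    exact absurd ⟨h.1.symm, h1, hb⟩ h.2
  · rw [h1] at hb
    exact mem_matchedPorts.2 ⟨j, h1, hb⟩

theorem AllowedFun.lt_of_none_mem (hZ : AllowedFun u Z) {v : Fin n}
    (h : none ∈ matchedPorts Z v) : ℓ v < u v := by
  obtain ⟨j, h1, h2⟩ := mem_matchedPorts.1 h
  obtain ⟨o, -, ho, h3⟩ := hZ.1 v j
  rw [h2] at h3
  exact ho (Prod.mk.inj (Sum.inl.inj h3)).2.symm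

theorem AllowedFun.card_matchedPorts (hZ : AllowedFun u Z) (v : Fin n) :
    ∃ bf bp : ℕ, (matchedPorts Z v).card + bf = n - 1 - ℓ v ∧
      bf + bp = ((badNodes Z).filter fun x => x.owner = v).card ∧
      ∀ s : Finset (Option (Fin n)),
        (∀ o ∈ s, (Sum.inl (v, o) : Node n ℓ) ∈ badNodes Z) → s.card ≤ bp := by
  classical
  let BF : Finset (Fin (n - 1 - ℓ v)) :=
    univ.filter fun j => (Sum.inr ⟨v, j⟩ : Node n ℓ) ∈ badNodes Z
  let BP : Finset (Option (Fin n)) :=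
    univ.filter fun o => (Sum.inl (v, o) : Node n ℓ) ∈ badNodes Z
  refine ⟨BF.card, BP.card, ?_, ?_, ?_⟩
  · choose f hf1 hf2 hf3 using hZ.1 v
    have himg : matchedPorts Z v =
        (univ.filter fun j => ¬ (Sum.inr ⟨v, j⟩ : Node n ℓ) ∈ badNodes Z).image f := by
      ext o
      rw [mem_matchedPorts, mem_image]
      constructor
      · rintro ⟨j, h1, h2⟩
        refine ⟨j, ?_, ?_⟩
        · simp only [mem_filter, mem_univ, true_and, mem_badNodes, not_not]
          rw [h2, h1]
        · have := hf3 j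
          rw [h2] at this
          exact (Prod.mk.inj (Sum.inl.inj this)).2.symm
      · rintro ⟨j, hj, rfl⟩
        simp only [mem_filter, mem_univ, true_and, mem_badNodes, not_not] at hj
        rw [hf3] at hj
        exact ⟨j, hj, hf3 j⟩
    rw [himg, card_image_of_injOn, add_comm]
    · have := card_filter_add_card_filter_not (s := (univ : Finset (Fin (n - 1 - ℓ v))))
        (fun j => (Sum.inr ⟨v, j⟩ : Node n ℓ) ∈ badNodes Z)
      simpa using this
    · intro j hj j' hj' hjj
      simp only [coe_filter, mem_univ, true_and, Set.mem_ofPred_eq, mem_badNodes, not_not]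
        at hj hj'
      rw [hf3] at hj hj'
      rw [hjj, hj'] at hj
      have := Sum.inr.inj hj
      simpa using this.symm
  · have : ((badNodes Z).filter fun x => x.owner = v) =
        (BF.map ⟨fun j => (Sum.inr ⟨v, j⟩ : Node n ℓ), fun j j' h => by
          simpa using Sum.inr.inj h⟩) ∪
        (BP.map ⟨fun o => (Sum.inl (v, o) : Node n ℓ), fun o o' h => by
          simpa using Sum.inl.inj h⟩) := by
      ext x
      simp only [mem_filter, mem_union, mem_map]
      constructor
      · rintro ⟨h1, h2⟩
        rcases x with ⟨v', o⟩ | ⟨v', j⟩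
        · obtain rfl : v' = v := h2
          right
          exact ⟨o, by simp [BP, h1], rfl⟩
        · obtain rfl : v' = v := h2
          left
          exact ⟨j, by simp [BF, h1], rfl⟩
      · rintro (⟨j, hj, rfl⟩ | ⟨o, ho, rfl⟩)
        · exact ⟨(mem_filter.1 hj).2, rfl⟩
        · exact ⟨(mem_filter.1 ho).2, rfl⟩
    rw [this, card_union_of_disjoint, card_map, card_map]
    rw [Finset.disjoint_left]
    intro x hx hx'
    simp only [mem_map] at hx hx'
    obtain ⟨j, -, rfl⟩ := hx
    obtain ⟨o, -, h⟩ := hx'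
    exact Sum.inl_ne_inr h
  · intro s hs
    refine card_le_card fun o ho => ?_
    simp only [BP, mem_filter, mem_univ, true_and]
    exact hs o ho

/-- The degrees of the graph of a near-matching. -/
theorem AllowedFun.degOf_graphOf (hZ : AllowedFun u Z) (v : Fin n) (hl : ℓ v + 1 ≤ n) :
    ∃ ε : ℕ, (ε = 0 ∨ ε = 1) ∧ (ε = 1 ↔ none ∈ matchedPorts Z v) ∧
      ℓ v + ε ≤ degOf (graphOf Z) v + ((badNodes Z).filter fun x => x.owner = v).card ∧
      degOf (graphOf Z) v ≤ ℓ v + ε + ((badNodes Z).filter fun x => x.owner = v).card := by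
  classical
  obtain ⟨bf, bp, h1, h2, h3⟩ := hZ.card_matchedPorts v
  have h4 := card_nonNbr (graphOf Z) v
  set N := (nonNbr (graphOf Z) v).map Function.Embedding.some with hN
  have hNc : N.card = (nonNbr (graphOf Z) v).card := card_map _
  have hup : ((matchedPorts Z v).erase none).card ≤ N.card := by
    refine card_le_card fun o ho => ?_
    rw [mem_erase] at ho
    cases o with
    | none => exact absurd rfl ho.1
    | some w => simpa [hN] using hZ.mem_nonNbr_of_some_mem ho.2
  have hlow : N.card ≤ ((matchedPorts Z v).erase none).card + bp := by
    have hsd := h3 (N \ (matchedPorts Z v).erase none) (by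
      intro o ho
      rw [mem_sdiff, mem_erase] at ho
      cases o with
      | none => simp [hN] at ho
      | some w =>
        by_contra hb
        refine ho.2 ⟨by simp, hZ.some_mem_of_mem_nonNbr ?_ hb⟩
        simpa [hN] using ho.1)
    have := card_le_card_sdiff_add_card (s := N) (t := (matchedPorts Z v).erase none)
    omega
  by_cases hn : none ∈ matchedPorts Z v
  · refine ⟨1, Or.inr rfl, by simp [hn], ?_⟩
    rw [card_erase_of_mem hn] at hup hlow
    have := card_pos.2 ⟨_, hn⟩
    omega
  · refine ⟨0, Or.inl rfl, by simp [hn], ?_⟩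
    rw [erase_eq_of_notMem hn] at hup hlow
    omega

theorem AllowedFun.exists_lifted (hlu : ∀ i, u i ≤ ℓ i + 1) (hZ : AllowedFun u Z)
    {G : SimpleGraph (Fin n)} (hG : memGlu n ℓ u G) :
    ∃ e : ∀ v, Fin (n - 1 - ℓ v) ≃ freePorts ℓ G v, ∀ v j o,
      Z (Sum.inr ⟨v, j⟩) = Sum.inl (v, o) → Z (Sum.inl (v, o)) = Sum.inr ⟨v, j⟩ →
      o ∈ freePorts ℓ G v → (e v j).1 = o := by
  classical
  have : ∀ v, ∃ e : Fin (n - 1 - ℓ v) ≃ freePorts ℓ G v, ∀ j o,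
      Z (Sum.inr ⟨v, j⟩) = Sum.inl (v, o) → Z (Sum.inl (v, o)) = Sum.inr ⟨v, j⟩ →
      o ∈ freePorts ℓ G v → (e j).1 = o := by
    intro v
    choose f hf1 hf2 hf3 using hZ.1 v
    obtain ⟨g, hg⟩ := Finset.exists_equiv_extend_of_card_eq (t := freePorts ℓ G v)
      (s := univ.filter fun j => Z (Sum.inl (v, f j)) = Sum.inr ⟨v, j⟩ ∧ f j ∈ freePorts ℓ G v)
      (f := f) (by rw [card_freePorts hlu hG, Fintype.card_fin])
      (by
        intro o ho
        simp only [mem_image, mem_filter, mem_univ, true_and] at ho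
        obtain ⟨j, hj, rfl⟩ := ho
        exact hj.2)
      (by
        intro j hj j' hj' hjj
        simp only [coe_filter, mem_univ, true_and, Set.mem_ofPred_eq] at hj hj'
        have h1 := hj.1
        rw [hjj, hj'.1] at h1
        simpa using (Sum.inr.inj h1).symm)
    refine ⟨g, fun j o h1 h2 h3 => ?_⟩
    have h4 : f j = o := by
      have := hf3 j
      rw [h1] at this
      exact (Prod.mk.inj (Sum.inl.inj this)).2.symm
    subst h4
    exact hg j (by simp [h2, h3])
  choose e he using this
  exact ⟨e, he⟩

open scoped Classical in
/-- Every near-matching is close to a perfect matching over any graph close to its own graph. -/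
theorem AllowedFun.exists_lifted_near (hlu : ∀ i, u i ≤ ℓ i + 1) (hZ : AllowedFun u Z)
    {G : SimpleGraph (Fin n)} (hG : memGlu n ℓ u G) :
    ∃ i : Lifted n ℓ u,
      hammingDist Z i.toFun ≤ 3 * (badNodes Z).card + 4 * graphDist G (graphOf Z) := by
  obtain ⟨e, he⟩ := hZ.exists_lifted hlu hG
  refine ⟨⟨⟨G, hG⟩, e⟩, ?_⟩
  change hammingDist Z (liftFun G e) ≤ _
  set Df : Finset (Fin n × Fin n) :=
    univ.filter fun p => ¬ (G.Adj p.1 p.2 ↔ (graphOf Z).Adj p.1 p.2) with hDf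
  have hDfc : Df.card = graphDist G (graphOf Z) := (graphDist_eq_card _ _).symm
  set T : Finset (Node n ℓ) := Df.image (fun p => Sum.inl (p.1, some p.2)) ∪
    (Df.image (fun p => Sum.inl (p.1, none)) ∪
      (badNodes Z).image (fun x => Sum.inl (x.owner, none))) with hT
  have hTc : T.card ≤ 2 * graphDist G (graphOf Z) + (badNodes Z).card := by
    have h1 := card_union_le (Df.image (fun p => (Sum.inl (p.1, some p.2) : Node n ℓ)))
      (Df.image (fun p => Sum.inl (p.1, none)) ∪
      (badNodes Z).image (fun x => Sum.inl (x.owner, none)))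
    have h2 := card_union_le (Df.image (fun p => (Sum.inl (p.1, none) : Node n ℓ)))
      ((badNodes Z).image (fun x => Sum.inl (x.owner, none)))
    have h3 := card_image_le (s := Df) (f := fun p => (Sum.inl (p.1, some p.2) : Node n ℓ))
    have h4 := card_image_le (s := Df) (f := fun p => (Sum.inl (p.1, none) : Node n ℓ))
    have h5 := card_image_le (s := badNodes Z)
      (f := fun x => (Sum.inl (x.owner, none) : Node n ℓ))
    rw [hT]
    omega
  have hkey : ∀ v o, (Sum.inl (v, o) : Node n ℓ) ∉ badNodes Z →
      (Sum.inl (v, o) : Node n ℓ) ∉ T → (o ∈ freePorts ℓ G v ↔ o ∈ matchedPorts Z v) := by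
    intro v o hb ht
    cases o with
    | none =>
      have hb0 : ((badNodes Z).filter fun x => x.owner = v).card = 0 := by
        rw [card_eq_zero, filter_eq_empty_iff]
        intro x hx hxv
        refine ht ?_
        rw [hT, mem_union, mem_union]
        refine Or.inr (Or.inr ?_)
        rw [mem_image]
        exact ⟨x, hx, by rw [hxv]⟩
      have hadj : ∀ w, G.Adj v w ↔ (graphOf Z).Adj v w := by
        intro w
        by_contra hw
        refine ht ?_
        rw [hT, mem_union, mem_union]
        refine Or.inr (Or.inl ?_)
        rw [mem_image]
        exact ⟨(v, w), by simp [hDf, hw], rfl⟩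
      have hdeg : degOf G v = degOf (graphOf Z) v := by
        rw [degOf_eq_card, degOf_eq_card]
        congr 1
        ext w
        simp [hadj w]
      have hn := card_nonNbr G v
      have hGv := hG v
      obtain ⟨ε, h1, h2, h3, h4⟩ := hZ.degOf_graphOf v (by omega)
      rw [none_mem_freePorts, ← h2, hdeg]
      omega
    | some w =>
      have hw : G.Adj v w ↔ (graphOf Z).Adj v w := by
        by_contra hw
        refine ht ?_
        rw [hT, mem_union]
        refine Or.inl ?_
        rw [mem_image]
        exact ⟨(v, w), by simp [hDf, hw], rfl⟩
      have : w ∈ nonNbr G v ↔ w ∈ nonNbr (graphOf Z) v := by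
        rw [mem_nonNbr, mem_nonNbr, hw]
      rw [some_mem_freePorts, this]
      exact ⟨fun h => hZ.some_mem_of_mem_nonNbr h hb, fun h => hZ.mem_nonNbr_of_some_mem h⟩
  have hsub : (univ.filter fun x => Z x ≠ liftFun G e x) ⊆ badNodes Z ∪ (T ∪ T.image Z) := by
    intro x hx
    rw [mem_filter] at hx
    replace hx := hx.2
    by_contra hx'
    rw [mem_union, mem_union, not_or, not_or] at hx'
    obtain ⟨hb, ht, hz⟩ := hx'
    have hzz : Z (Z x) = x := by simpa [mem_badNodes] using hb
    rcases x with ⟨v, o⟩ | ⟨v, j⟩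
    · have hk := hkey v o hb ht
      by_cases hm : o ∈ matchedPorts Z v
      · obtain ⟨j, h1, h2⟩ := mem_matchedPorts.1 hm
        refine hx ?_
        rw [h1, liftFun_of_apply (he v j o h2 h1 (hk.2 hm))]
      · rcases hZ.2 v o with h1 | ⟨j, h1⟩
        · refine hx ?_
          rw [h1, liftFun_of_notMem (fun h => hm (hk.1 h))]
        · rw [h1] at hzz
          exact hm (mem_matchedPorts.2 ⟨j, h1, hzz⟩)
    · obtain ⟨o, -, -, ho⟩ := hZ.1 v j
      rw [ho] at hzz
      have hm : o ∈ matchedPorts Z v := mem_matchedPorts.2 ⟨j, hzz, ho⟩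
      have hT' : (Sum.inl (v, o) : Node n ℓ) ∉ T := by
        intro h
        exact hz (mem_image.2 ⟨_, h, hzz⟩)
      have hb' : (Sum.inl (v, o) : Node n ℓ) ∉ badNodes Z := by
        rw [mem_badNodes, not_not, hzz, ho]
      have := (hkey v o hb' hT').2 hm
      refine hx ?_
      rw [ho, liftFun_filler, he v j o ho hzz this]
  have h1 := card_le_card hsub
  have h2 := card_union_le (badNodes Z) (T ∪ T.image Z)
  have h3 := card_union_le T (T.image Z)
  have h4 := card_image_le (s := T) (f := Z)
  have h5 : hammingDist Z (liftFun G e) = (univ.filter fun x => Z x ≠ liftFun G e x).card := by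
    unfold hammingDist
    congr
  omega

end near

section flow

theorem card_hammingBall_le {X Y : Type*} [Fintype X] [DecidableEq X] [Nonempty X] [Fintype Y]
    [DecidableEq Y] (f : X → Y) (k : ℕ) :
    (univ.filter fun Z : X → Y => hammingDist Z f ≤ k).card ≤
      (Fintype.card X * Fintype.card Y) ^ k := by
  induction k with
  | zero =>
    rw [pow_zero]
    refine card_le_one.2 fun a ha b hb => ?_
    simp only [mem_filter, mem_univ, true_and, Nat.le_zero, hammingDist_eq_zero] at ha hb
    rw [ha, hb]
  | succ k ih =>
    have hsub : (univ.filter fun Z : X → Y => hammingDist Z f ≤ k + 1) ⊆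
        ((univ.filter fun Z : X → Y => hammingDist Z f ≤ k) ×ˢ (univ : Finset (X × Y))).image
          fun p => Function.update p.1 p.2.1 p.2.2 := by
      intro Z hZ
      simp only [mem_filter, mem_univ, true_and] at hZ
      obtain ⟨x, hx⟩ : ∃ x, hammingDist (Function.update Z x (f x)) f ≤ k := by
        by_cases h : Z = f
        · subst h
          refine ⟨Classical.arbitrary X, ?_⟩
          simp
        · obtain ⟨x, hx⟩ := Function.ne_iff.1 h
          refine ⟨x, Nat.lt_succ_iff.1 (lt_of_lt_of_le ?_ hZ)⟩
          refine card_lt_card ?_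
          rw [ssubset_iff_of_subset]
          · refine ⟨x, by simpa using hx, by simp⟩
          · intro y hy
            simp only [mem_filter, mem_univ, true_and] at hy ⊢
            by_cases hyx : y = x
            · subst hyx
              exact hx
            · rwa [Function.update_of_ne hyx] at hy
      refine mem_image.2 ⟨(Function.update Z x (f x), x, Z x), ?_, ?_⟩
      · simp [hx]
      · simp
    refine (card_le_card hsub).trans (card_image_le.trans ?_)
    rw [card_product, card_univ, Fintype.card_prod, pow_succ]
    exact Nat.mul_le_mul_right _ ih

/-- The edges of `H` leaving `S`. -/
def cut {X : Type*} [Fintype X] [DecidableEq X] (H : X → Finset X) (S : Finset X) :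
    Finset (X × X) :=
  univ.filter fun p => p.1 ∈ S ∧ p.2 ∉ S ∧ p.2 ∈ H p.1

theorem mem_cut {X : Type*} [Fintype X] [DecidableEq X] {H : X → Finset X} {S : Finset X}
    {p : X × X} : p ∈ cut H S ↔ p.1 ∈ S ∧ p.2 ∉ S ∧ p.2 ∈ H p.1 := by
  simp [cut]

theorem cut_insert_subset {X : Type*} [Fintype X] [DecidableEq X] {H : X → Finset X}
    {S : Finset X} {y : X} :
    cut H (insert y S) ⊆ (cut H S).filter (fun p => p.2 ≠ y) ∪
      ((H y).filter fun z => z ∉ S).image fun z => (y, z) := by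
  rintro ⟨a, b⟩ h
  simp only [mem_cut, mem_insert, not_or, mem_union, mem_filter, mem_image] at h ⊢
  obtain ⟨rfl | h1, ⟨h2, h3⟩, h4⟩ := h
  · exact Or.inr ⟨b, ⟨h4, h3⟩, rfl⟩
  · exact Or.inl ⟨⟨h1, h3, h4⟩, h2⟩

theorem exists_insert_cut_le_two {X : Type*} [Fintype X] [DecidableEq X] {H : X → Finset X}
    (hsymm : ∀ x y, y ∈ H x → x ∈ H y) (hcard : ∀ x, (H x).card ≤ 2) {S : Finset X}
    (hS : (cut H S).card ≤ 2) (hne : S ≠ univ) :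
    ∃ y, y ∉ S ∧ (cut H (insert y S)).card ≤ 2 := by
  by_cases h0 : cut H S = ∅
  · obtain ⟨y, hy⟩ : ∃ y, y ∉ S := by
      by_contra! h
      exact hne (eq_univ_iff_forall.2 h)
    refine ⟨y, hy, (card_le_card cut_insert_subset).trans ?_⟩
    rw [h0, filter_empty, empty_union]
    exact card_image_le.trans ((card_filter_le _ _).trans (hcard y))
  · obtain ⟨⟨x, y⟩, hxy⟩ := nonempty_iff_ne_empty.2 h0
    have hxy' := mem_cut.1 hxy
    refine ⟨y, hxy'.2.1, (card_le_card cut_insert_subset).trans ((card_union_le _ _).trans ?_)⟩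
    have h1 : ((cut H S).filter fun p => p.2 ≠ y).card < (cut H S).card := by
      refine card_lt_card ((ssubset_iff_of_subset (filter_subset _ _)).2 ⟨_, hxy, ?_⟩)
      simp
    have h2 : ((H y).filter fun z => z ∉ S).card < (H y).card := by
      refine card_lt_card ((ssubset_iff_of_subset (filter_subset _ _)).2
        ⟨x, hsymm _ _ hxy'.2.2, ?_⟩)
      simp [hxy'.1]
    have h3 := card_image_le (s := (H y).filter fun z => z ∉ S) (f := fun z => (y, z))
    have h4 := hcard y
    omega

/-- A graph of maximum degree two has cutwidth at most two. -/
theorem exists_order_cut_le_two {X : Type*} [Fintype X] [DecidableEq X] [Nonempty X]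
    {H : X → Finset X}
    (hsymm : ∀ x y, y ∈ H x → x ∈ H y) (hcard : ∀ x, (H x).card ≤ 2) :
    ∃ S : ℕ → Finset X, S 0 = ∅ ∧ S (Fintype.card X) = univ ∧ (∀ k, (cut H (S k)).card ≤ 2) ∧
      ∀ k, ∃ x, ∀ y, y ≠ x → (y ∈ S (k + 1) ↔ y ∈ S k) := by
  have step : ∀ S : {S : Finset X // (cut H S).card ≤ 2},
      ∃ T : {S : Finset X // (cut H S).card ≤ 2},
      (∃ x, ∀ y, y ≠ x → (y ∈ T.1 ↔ y ∈ S.1)) ∧ (T.1 = univ ∨ S.1.card + 1 ≤ T.1.card) := by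
    rintro ⟨S, hS⟩
    by_cases h : S = univ
    · exact ⟨⟨S, hS⟩, ⟨Classical.arbitrary X, fun y _ => Iff.rfl⟩, Or.inl h⟩
    · obtain ⟨y, hy, hc⟩ := exists_insert_cut_le_two hsymm hcard hS h
      refine ⟨⟨insert y S, hc⟩, ⟨y, fun z hz => by simp [hz]⟩, Or.inr ?_⟩
      rw [card_insert_of_notMem hy]
  choose next hn1 hn2 using step
  let T : ℕ → {S : Finset X // (cut H S).card ≤ 2} := fun k =>
    Nat.rec ⟨∅, by simp [cut]⟩ (fun _ S => next S) k
  have hT : ∀ k, (T k).1 = univ ∨ k ≤ (T k).1.card := by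
    intro k
    induction k with
    | zero => exact Or.inr (Nat.zero_le _)
    | succ k ih =>
      change (next (T k)).1 = univ ∨ k + 1 ≤ (next (T k)).1.card
      rcases hn2 (T k) with h | h
      · exact Or.inl h
      · rcases ih with h' | h'
        · rw [h', card_univ] at h
          have := card_le_univ (next (T k)).1
          omega
        · exact Or.inr (by omega)
  refine ⟨fun k => (T k).1, rfl, ?_, fun k => (T k).2, fun k => hn1 (T k)⟩
  rcases hT (Fintype.card X) with h | h
  · exact h
  · exact (card_eq_iff_eq_univ _).1 (le_antisymm (card_le_univ _) h)

theorem sq_sub_le_card_mul_sum (g : ℕ → ℝ) (m : ℕ) :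
    (g 0 - g m) ^ 2 ≤ m * ∑ k ∈ range m, (g k - g (k + 1)) ^ 2 := by
  have h := sq_sum_le_card_mul_sum_sq (s := range m) (f := fun k => g k - g (k + 1))
  rwa [sum_range_sub', card_range] at h

/-- The hybrid of `f` and `g` that follows `g` on `S`. -/
def hybrid {X : Type*} [DecidableEq X] (f g : X → X) (S : Finset X) : X → X :=
  fun x => if x ∈ S then g x else f x

theorem hybrid_of_mem {X : Type*} [DecidableEq X] {f g : X → X} {S : Finset X} {x : X}
    (h : x ∈ S) : hybrid f g S x = g x := if_pos h

theorem hybrid_of_notMem {X : Type*} [DecidableEq X] {f g : X → X} {S : Finset X} {x : X}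
    (h : x ∉ S) : hybrid f g S x = f x := if_neg h

theorem hybrid_hybrid_left {X : Type*} [DecidableEq X] (f g : X → X) (S : Finset X) :
    hybrid (hybrid f g S) (hybrid g f S) S = f := by
  funext x
  by_cases h : x ∈ S <;> simp [hybrid, h]

theorem pair_hybrid {X : Type*} [DecidableEq X] (f g : X → X) (S : Finset X) (x : X) :
    ({hybrid f g S x, hybrid g f S x} : Finset X) = {f x, g x} := by
  by_cases h : x ∈ S
  · rw [hybrid_of_mem h, hybrid_of_mem h, pair_comm]
  · rw [hybrid_of_notMem h, hybrid_of_notMem h]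

theorem card_bad_hybrid_le {X : Type*} [Fintype X] [DecidableEq X] {f g : X → X}
    (hf : ∀ x, f (f x) = x) (hg : ∀ x, g (g x) = x) (S : Finset X) :
    (univ.filter fun x => hybrid f g S (hybrid f g S x) ≠ x).card ≤
      2 * (cut (fun x => {f x, g x}) S).card := by
  have hsub : (univ.filter fun x => hybrid f g S (hybrid f g S x) ≠ x) ⊆
      (cut (fun x => {f x, g x}) S).image Prod.fst ∪
        (cut (fun x => {f x, g x}) S).image Prod.snd := by
    intro x hx
    simp only [mem_filter, mem_univ, true_and] at hx
    rw [mem_union, mem_image, mem_image]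
    by_cases h : x ∈ S
    · left
      rw [hybrid_of_mem h] at hx
      by_cases h' : g x ∈ S
      · rw [hybrid_of_mem h', hg] at hx
        exact absurd rfl hx
      · exact ⟨(x, g x), mem_cut.2 ⟨h, h', by simp⟩, rfl⟩
    · right
      rw [hybrid_of_notMem h] at hx
      by_cases h' : f x ∈ S
      · exact ⟨(f x, x), mem_cut.2 ⟨h', h, by simp [hf]⟩, rfl⟩
      · rw [hybrid_of_notMem h', hf] at hx
        exact absurd rfl hx
  have h1 := card_le_card hsub
  have h2 := card_union_le ((cut (fun x => {f x, g x}) S).image Prod.fst)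
    ((cut (fun x => {f x, g x}) S).image Prod.snd)
  have h3 := card_image_le (s := cut (fun x => {f x, g x}) S) (f := Prod.fst)
  have h4 := card_image_le (s := cut (fun x => {f x, g x}) S) (f := Prod.snd)
  omega

theorem hammingDist_hybrid_le_one {X : Type*} [Fintype X] [DecidableEq X] {f g : X → X}
    {S T : Finset X} (h : ∃ x, ∀ y, y ≠ x → (y ∈ T ↔ y ∈ S)) :
    hammingDist (hybrid f g S) (hybrid f g T) ≤ 1 := by
  obtain ⟨x, hx⟩ := h
  refine (card_le_card (t := {x}) fun y hy => ?_).trans (card_singleton x).le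
  rw [mem_singleton]
  by_contra hne
  refine (mem_filter.1 hy).2 ?_
  simp only [hybrid, hx y hne]

/-- Canonical paths between involutions: if all hybrids of involutions of a family with at most
four defects are close to the family, then the Dirichlet form of the complete graph on the family
is controlled by that of the graph of close pairs. -/
theorem sum_sq_sub_le_of_hybrid {X I : Type*} [Fintype X] [DecidableEq X] [Nonempty X]
    [Fintype I] [DecidableEq I] (t : I → X → X) (htinj : Function.Injective t)
    (ht : ∀ i x, t i (t i x) = x) (K : ℕ)
    (hnear : ∀ i j S, (univ.filter fun x =>
      hybrid (t i) (t j) S (hybrid (t i) (t j) S x) ≠ x).card ≤ 4 →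
      ∃ a, hammingDist (hybrid (t i) (t j) S) (t a) ≤ K) (f : I → ℝ) :
    ∑ i, ∑ j, (f i - f j) ^ 2 ≤
      (Fintype.card X : ℝ) ^ 2 * ((Fintype.card X : ℝ) ^ 2) ^ (2 * K) * Fintype.card I *
        ∑ i, ∑ j, if hammingDist (t i) (t j) ≤ 2 * K + 1 then (f i - f j) ^ 2 else 0 := by
  by_cases hI : Nonempty I
  swap
  · rw [not_nonempty_iff] at hI
    simp
  set m := Fintype.card X with hm
  -- a retraction onto the family
  obtain ⟨R, hRt, hR⟩ : ∃ R : (X → X) → I, (∀ i, R (t i) = i) ∧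
      ∀ Z, (∃ a, hammingDist Z (t a) ≤ K) → hammingDist Z (t (R Z)) ≤ K := by
    have : ∀ Z : X → X, ∃ r : I, (∀ i, Z = t i → r = i) ∧
        ((∃ a, hammingDist Z (t a) ≤ K) → hammingDist Z (t r) ≤ K) := by
      intro Z
      by_cases h : ∃ i, Z = t i
      · obtain ⟨i, rfl⟩ := h
        exact ⟨i, fun j hj => htinj hj, fun _ => by simp⟩
      · by_cases h' : ∃ a, hammingDist Z (t a) ≤ K
        · obtain ⟨a, ha⟩ := h'
          exact ⟨a, fun i hi => absurd ⟨i, hi⟩ h, fun _ => ha⟩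
        · exact ⟨Classical.arbitrary I, fun i hi => absurd ⟨i, hi⟩ h, fun h'' => absurd h'' h'⟩
    choose R h1 h2 using this
    exact ⟨R, fun i => h1 _ i rfl, h2⟩
  -- the orderings
  obtain ⟨S, hS0, hSm, hScut, hSstep⟩ : ∃ S : (X → Finset X) → ℕ → Finset X,
      (∀ i j, S (fun x => {t i x, t j x}) 0 = ∅) ∧
      (∀ i j, S (fun x => {t i x, t j x}) m = univ) ∧
      (∀ i j k, (cut (fun x => {t i x, t j x}) (S (fun x => {t i x, t j x}) k)).card ≤ 2) ∧
      ∀ i j k, ∃ x, ∀ y, y ≠ x →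
        (y ∈ S (fun x => {t i x, t j x}) (k + 1) ↔ y ∈ S (fun x => {t i x, t j x}) k) := by
    have : ∀ H : X → Finset X, ∃ S : ℕ → Finset X,
        ((∀ x y, y ∈ H x → x ∈ H y) ∧ ∀ x, (H x).card ≤ 2) → S 0 = ∅ ∧ S m = univ ∧
          (∀ k, (cut H (S k)).card ≤ 2) ∧ ∀ k, ∃ x, ∀ y, y ≠ x → (y ∈ S (k + 1) ↔ y ∈ S k) := by
      intro H
      by_cases h : (∀ x y, y ∈ H x → x ∈ H y) ∧ ∀ x, (H x).card ≤ 2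
      · obtain ⟨S, hS⟩ := exists_order_cut_le_two h.1 h.2
        exact ⟨S, fun _ => hS⟩
      · exact ⟨fun _ => ∅, fun h' => absurd h' h⟩
    choose S hS using this
    have hH : ∀ i j, (∀ x y, y ∈ ({t i x, t j x} : Finset X) → x ∈ ({t i y, t j y} : Finset X)) ∧
        ∀ x, ({t i x, t j x} : Finset X).card ≤ 2 := by
      intro i j
      refine ⟨fun x y hy => ?_, fun x => card_le_two⟩
      rw [mem_insert, mem_singleton] at hy ⊢
      rcases hy with rfl | rfl
      · left; rw [ht]
      · right; rw [ht]
    exact ⟨S, fun i j => (hS _ (hH i j)).1, fun i j => (hS _ (hH i j)).2.1,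
      fun i j => (hS _ (hH i j)).2.2.1, fun i j => (hS _ (hH i j)).2.2.2⟩
  let Sg : I → I → ℕ → Finset X := fun i j k => S (fun x => {t i x, t j x}) k
  let Z : I → I → ℕ → X → X := fun i j k => hybrid (t i) (t j) (Sg i j k)
  have hSsymm : ∀ i j k, Sg j i k = Sg i j k := by
    intro i j k
    change S _ k = S _ k
    simp only [pair_comm]
  let L : I → I → ℕ → X → X := fun i j k => hybrid (t j) (t i) (Sg i j k)
  have hLZ : ∀ i j k, L i j k = Z j i k := by
    intro i j k
    change hybrid _ _ _ = hybrid _ _ _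
    rw [hSsymm]
  let Near : Finset (X → X) := univ.filter fun Z => hammingDist Z (t (R Z)) ≤ K
  have hZnear : ∀ i j k, Z i j k ∈ Near := by
    intro i j k
    simp only [Near, mem_filter, mem_univ, true_and]
    refine hR _ (hnear i j _ ?_)
    have h1 := card_bad_hybrid_le (ht i) (ht j) (Sg i j k)
    have h2 := hScut i j k
    change (cut (fun x => {t i x, t j x}) (Sg i j k)).card ≤ 2 at h2
    omega
  have hLnear : ∀ i j k, L i j k ∈ Near := fun i j k => by rw [hLZ]; exact hZnear j i k
  have hZ0 : ∀ i j, Z i j 0 = t i := by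
    intro i j
    funext x
    exact hybrid_of_notMem (by rw [show Sg i j 0 = ∅ from hS0 i j]; simp)
  have hZm : ∀ i j, Z i j m = t j := by
    intro i j
    funext x
    exact hybrid_of_mem (by rw [show Sg i j m = univ from hSm i j]; simp)
  have hinj : ∀ k, Set.InjOn (fun p : I × I => (Z p.1 p.2 k, L p.1 p.2 k))
      (univ : Finset (I × I)) := by
    rintro k ⟨i, j⟩ - ⟨i', j'⟩ - h
    have h1 : Z i j k = Z i' j' k := congrArg Prod.fst h
    have h2 : L i j k = L i' j' k := congrArg Prod.snd h
    have hH : (fun x => ({t i x, t j x} : Finset X)) = fun x => {t i' x, t j' x} := by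
      funext x
      rw [← pair_hybrid (t i) (t j) (Sg i j k), ← pair_hybrid (t i') (t j') (Sg i' j' k)]
      change ({Z i j k x, L i j k x} : Finset X) = {Z i' j' k x, L i' j' k x}
      rw [h1, h2]
    have hSS : Sg i j k = Sg i' j' k := by
      change S _ k = S _ k
      rw [hH]
    have e1 : t i = t i' := by
      rw [← hybrid_hybrid_left (t i) (t j) (Sg i j k),
        ← hybrid_hybrid_left (t i') (t j') (Sg i' j' k)]
      change hybrid (Z i j k) (L i j k) _ = hybrid (Z i' j' k) (L i' j' k) _
      rw [h1, h2, hSS]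
    have e2 : t j = t j' := by
      rw [← hybrid_hybrid_left (t j) (t i) (Sg i j k),
        ← hybrid_hybrid_left (t j') (t i') (Sg i' j' k)]
      change hybrid (L i j k) (Z i j k) _ = hybrid (L i' j' k) (Z i' j' k) _
      rw [h1, h2, hSS]
    rw [htinj e1, htinj e2]
  set B : ℕ := (m * m) ^ K with hB
  have hball : ∀ a, (univ.filter fun Z : X → X => hammingDist Z (t a) ≤ K).card ≤ B := fun a =>
    card_hammingBall_le _ _
  let h : I → ℝ := fun i =>
    ∑ j, if hammingDist (t i) (t j) ≤ 2 * K + 1 then (f i - f j) ^ 2 else 0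
  have hh : ∀ i, 0 ≤ h i := fun i => sum_nonneg fun j _ => by split_ifs <;> positivity
  have hnearmaps : ∀ Z ∈ Near, R Z ∈ (univ : Finset I) := fun _ _ => mem_univ _
  have hfib : ∀ a, ((Near.filter fun Z => R Z = a).card : ℝ) ≤ B := by
    intro a
    refine Nat.cast_le.2 (le_trans (card_le_card fun Z hZ => ?_) (hball a))
    simp only [Near, mem_filter, mem_univ, true_and] at hZ ⊢
    rw [← hZ.2]
    exact hZ.1
  have hNearcard : (Near.card : ℝ) ≤ B * Fintype.card I := by
    rw [card_eq_sum_card_fiberwise hnearmaps, Nat.cast_sum]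
    refine (sum_le_sum fun a _ => hfib a).trans ?_
    rw [sum_const, card_univ, nsmul_eq_mul, mul_comm]
  have hNearsum : ∑ Z ∈ Near, h (R Z) ≤ B * ∑ a, h a := by
    rw [← sum_fiberwise_of_maps_to hnearmaps, mul_sum]
    refine sum_le_sum fun a _ => ?_
    rw [sum_congr rfl (g := fun _ => h a) (fun Z hZ => by rw [(mem_filter.1 hZ).2]), sum_const,
      nsmul_eq_mul]
    exact mul_le_mul_of_nonneg_right (hfib a) (hh a)
  have hstep : ∀ i j k, (f (R (Z i j k)) - f (R (Z i j (k + 1)))) ^ 2 ≤ h (R (Z i j k)) := by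
    intro i j k
    have hd : hammingDist (t (R (Z i j k))) (t (R (Z i j (k + 1)))) ≤ 2 * K + 1 := by
      have a1 := (mem_filter.1 (hZnear i j k)).2
      have a2 := (mem_filter.1 (hZnear i j (k + 1))).2
      have a3 : hammingDist (Z i j k) (Z i j (k + 1)) ≤ 1 :=
        hammingDist_hybrid_le_one (hSstep i j k)
      have a4 := hammingDist_triangle (t (R (Z i j k))) (Z i j k) (t (R (Z i j (k + 1))))
      have a5 := hammingDist_triangle (Z i j k) (Z i j (k + 1)) (t (R (Z i j (k + 1))))
      rw [hammingDist_comm] at a1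
      omega
    have := single_le_sum (s := univ) (f := fun b =>
      if hammingDist (t (R (Z i j k))) (t b) ≤ 2 * K + 1 then
        (f (R (Z i j k)) - f b) ^ 2 else 0)
      (fun b _ => by split_ifs <;> positivity) (mem_univ (R (Z i j (k + 1))))
    rwa [if_pos hd] at this
  have hk : ∀ k, ∑ i, ∑ j, h (R (Z i j k)) ≤
      B * Fintype.card I * (B * ∑ a, h a) := by
    intro k
    calc ∑ i, ∑ j, h (R (Z i j k)) = ∑ p : I × I, h (R (Z p.1 p.2 k)) :=
          (Fintype.sum_prod_type' fun i j => h (R (Z i j k))).symm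
      _ = ∑ q ∈ univ.image (fun p : I × I => (Z p.1 p.2 k, L p.1 p.2 k)), h (R q.1) :=
          (sum_image (f := fun q : (X → X) × (X → X) => h (R q.1)) (hinj k)).symm
      _ ≤ ∑ q ∈ Near ×ˢ Near, h (R q.1) := by
          refine sum_le_sum_of_subset_of_nonneg ?_ fun _ _ _ => hh _
          intro q hq
          obtain ⟨p, -, rfl⟩ := mem_image.1 hq
          exact mem_product.2 ⟨hZnear _ _ _, hLnear _ _ _⟩
      _ = Near.card * ∑ Z ∈ Near, h (R Z) := by
          rw [sum_product, mul_sum]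
          refine sum_congr rfl fun Z _ => ?_
          change ∑ _ ∈ Near, h (R Z) = _
          rw [sum_const, nsmul_eq_mul]
      _ ≤ B * Fintype.card I * (B * ∑ a, h a) :=
          mul_le_mul hNearcard hNearsum (sum_nonneg fun _ _ => hh _) (by positivity)
  calc ∑ i, ∑ j, (f i - f j) ^ 2
      ≤ ∑ i, ∑ j, m * ∑ k ∈ range m, h (R (Z i j k)) := by
        refine sum_le_sum fun i _ => sum_le_sum fun j _ => ?_
        have h1 := sq_sub_le_card_mul_sum (fun k => f (R (Z i j k))) m
        simp only [hZ0, hZm, hRt] at h1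
        refine h1.trans (mul_le_mul_of_nonneg_left ?_ (Nat.cast_nonneg _))
        exact sum_le_sum fun k _ => hstep i j k
    _ = m * ∑ k ∈ range m, ∑ i, ∑ j, h (R (Z i j k)) := by
        simp only [← mul_sum]
        congr 1
        rw [sum_comm' (s := range m) (t := fun _ => univ) (s' := fun _ => range m) (t' := univ)
          (by simp)]
        refine sum_congr rfl fun i _ => ?_
        rw [sum_comm]
    _ ≤ m * ∑ k ∈ range m, (B * Fintype.card I * (B * ∑ a, h a)) :=
        mul_le_mul_of_nonneg_left (sum_le_sum fun k _ => hk k) (Nat.cast_nonneg _)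
    _ = (m : ℝ) ^ 2 * ((m : ℝ) ^ 2) ^ (2 * K) * Fintype.card I * ∑ a, h a := by
        rw [sum_const, card_range, nsmul_eq_mul, hB]
        push_cast
        ring

end flow

theorem AllowedFun.hybrid {n : ℕ} {ℓ u : Fin n → ℕ} {Z W : Node n ℓ → Node n ℓ}
    (hZ : AllowedFun u Z) (hW : AllowedFun u W) (S : Finset (Node n ℓ)) :
    AllowedFun u (hybrid Z W S) := by
  refine ⟨fun v j => ?_, fun v o => ?_⟩
  · by_cases h : (Sum.inr ⟨v, j⟩ : Node n ℓ) ∈ S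
    · rw [hybrid_of_mem h]
      exact hW.1 v j
    · rw [hybrid_of_notMem h]
      exact hZ.1 v j
  · by_cases h : (Sum.inl (v, o) : Node n ℓ) ∈ S
    · rw [hybrid_of_mem h]
      exact hW.2 v o
    · rw [hybrid_of_notMem h]
      exact hZ.2 v o

/-- Graphs violating the degree intervals by at most `D` in total are within distance `K` of a
graph satisfying them. -/
def Repairable (n : ℕ) (ℓ u : Fin n → ℕ) (D K : ℕ) : Prop :=
  ∀ (G : SimpleGraph (Fin n)) (b : Fin n → ℕ), (∀ v, ℓ v ≤ degOf G v + b v) →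
    (∀ v, degOf G v ≤ u v + b v) → ∑ v, b v ≤ D →
    ∃ G' : SimpleGraph (Fin n), memGlu n ℓ u G' ∧ graphDist G' G ≤ K

theorem AllowedFun.exists_lifted_le {n : ℕ} {ℓ u : Fin n → ℕ}
    (hlu : ∀ i, ℓ i ≤ u i ∧ u i ≤ ℓ i + 1) (hln : ∀ i, ℓ i + 1 ≤ n) {D K : ℕ}
    (hrep : Repairable n ℓ u D K) {Z : Node n ℓ → Node n ℓ} (hZ : AllowedFun u Z)
    (hbad : (badNodes Z).card ≤ D) :
    ∃ i : Lifted n ℓ u, hammingDist Z i.toFun ≤ 3 * D + 4 * K := by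
  classical
  obtain ⟨b, hb⟩ : ∃ b : Fin n → ℕ, ∀ v, ((badNodes Z).filter fun x => x.owner = v).card = b v :=
    ⟨_, fun _ => rfl⟩
  have hsum : ∑ v, b v = (badNodes Z).card := by
    rw [card_eq_sum_card_fiberwise (f := Node.owner) (t := univ) fun x _ => mem_univ _]
    exact sum_congr rfl fun v _ => (hb v).symm
  obtain ⟨G', hG', hd⟩ := hrep (graphOf Z) b
    (fun v => by
      obtain ⟨ε, -, -, h, -⟩ := hZ.degOf_graphOf v (hln v)
      have := hb v
      omega)
    (fun v => by
      obtain ⟨ε, h1, h2, -, h⟩ := hZ.degOf_graphOf v (hln v)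
      have h3 := hlu v
      have h4 : ℓ v + ε ≤ u v := by
        rcases h1 with rfl | rfl
        · omega
        · have := hZ.lt_of_none_mem (h2.1 rfl)
          omega
      have := hb v
      omega)
    (by omega)
  obtain ⟨i, hi⟩ := hZ.exists_lifted_near (fun i => (hlu i).2) hG'
  refine ⟨i, le_trans ?_ (show 3 * (badNodes Z).card + 4 * graphDist G' (graphOf Z) ≤ _ by omega)⟩
  convert hi

theorem Lifted.graphDist_le {n : ℕ} {ℓ u : Fin n → ℕ} [DecidableEq (Node n ℓ)]
    (i j : Lifted n ℓ u) :
    graphDist i.1.1 j.1.1 ≤ hammingDist i.toFun j.toFun := by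
  classical
  rw [graphDist_eq_card]
  refine card_le_card_of_injOn (fun p => (Sum.inl (p.1, some p.2) : Node n ℓ)) ?_ ?_
  · rintro ⟨v, w⟩ hp
    have hp' := (mem_filter.1 (mem_coe.1 hp)).2
    refine mem_coe.2 (mem_filter.2 ⟨mem_univ _, fun h => hp' ?_⟩)
    by_cases hvw : v = w
    · subst hvw
      simp
    · change liftFun _ _ _ = liftFun _ _ _ at h
      rw [← liftFun_eq_inl_iff (e := i.2) hvw, ← liftFun_eq_inl_iff (e := j.2) hvw]
      rw [h]
  · rintro ⟨v, w⟩ - ⟨v', w'⟩ - h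
    simpa using h

theorem sum_sq_sub_le_of_repairable {n : ℕ} [NeZero n] {ℓ u : Fin n → ℕ}
    (hlu : ∀ i, ℓ i ≤ u i ∧ u i ≤ ℓ i + 1) (hln : ∀ i, ℓ i + 1 ≤ n) {K : ℕ}
    (hrep : Repairable n ℓ u 4 K) [Fintype (IntervalGraph n ℓ u)]
    (f : IntervalGraph n ℓ u → ℝ) :
    ∑ A, ∑ B, (f A - f B) ^ 2 ≤
      (Fintype.card (Node n ℓ) : ℝ) ^ (32 * K + 100) *
        Fintype.card (IntervalGraph n ℓ u) *
        ∑ A, ∑ B, if graphDist A.1 B.1 ≤ 8 * K + 25 then (f A - f B) ^ 2 else 0 := by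
  classical
  have : Nonempty (Node n ℓ) := ⟨Sum.inl (0, none)⟩
  set N : ℕ := ∏ v, (n - 1 - ℓ v).factorial with hN
  have hNpos : (0 : ℝ) < N := Nat.cast_pos.2 (prod_pos fun v _ => Nat.factorial_pos _)
  have hfib : ∀ G : IntervalGraph n ℓ u, Fintype.card (∀ v, Fin (n - 1 - ℓ v) ≃ freePorts ℓ G.1 v) = N := by
    intro G
    rw [Fintype.card_pi]
    refine prod_congr rfl fun v _ => ?_
    have hc : Fintype.card (Fin (n - 1 - ℓ v)) = Fintype.card (freePorts ℓ G.1 v) := by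
      rw [Fintype.card_fin, Fintype.card_coe, card_freePorts (fun i => (hlu i).2) G.2]
    rw [Fintype.card_equiv (Fintype.equivOfCardEq hc), Fintype.card_fin]
  have hsum : ∀ g : IntervalGraph n ℓ u → ℝ, ∑ i : Lifted n ℓ u, g i.1 = N * ∑ G, g G := by
    intro g
    have h1 : ∑ i : Lifted n ℓ u, g i.1 =
        ∑ G : IntervalGraph n ℓ u, ∑ _e : ∀ v, Fin (n - 1 - ℓ v) ≃ freePorts ℓ G.1 v, g G :=
      Fintype.sum_sigma (fun i : (Σ G : IntervalGraph n ℓ u, ∀ v, Fin (n - 1 - ℓ v) ≃ freePorts ℓ G.1 v) => g i.1)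
    rw [h1, mul_sum]
    refine sum_congr rfl fun G _ => ?_
    rw [sum_const, card_univ, hfib, nsmul_eq_mul]
  have hcard : (Fintype.card (Lifted n ℓ u) : ℝ) = N * Fintype.card (IntervalGraph n ℓ u) := by
    have := hsum fun _ => 1
    simpa using this
  set m : ℝ := (Fintype.card (Node n ℓ) : ℝ) with hm
  set K' : ℕ := 3 * 4 + 4 * K with hK'
  have hflow := sum_sq_sub_le_of_hybrid (Lifted.toFun (n := n) (ℓ := ℓ) (u := u))
    Lifted.toFun_injective (fun i x => liftFun_liftFun x) K' (fun i j S hS => by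
      refine (i.allowedFun.hybrid j.allowedFun S).exists_lifted_le hlu hln hrep ?_
      refine le_trans (card_le_card fun x hx => ?_) hS
      simpa using mem_badNodes.1 hx) (fun i => f i.1)
  have hleft : ∑ i : Lifted n ℓ u, ∑ j : Lifted n ℓ u, (f i.1 - f j.1) ^ 2 =
      N * (N * ∑ A, ∑ B, (f A - f B) ^ 2) := by
    rw [mul_sum (f := fun A => ∑ B, (f A - f B) ^ 2), ← hsum]
    refine sum_congr rfl fun i _ => ?_
    exact hsum fun B => (f i.1 - f B) ^ 2
  have hright : ∑ i : Lifted n ℓ u, ∑ j : Lifted n ℓ u,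
      (if hammingDist i.toFun j.toFun ≤ 2 * K' + 1 then (f i.1 - f j.1) ^ 2 else 0) ≤
      N * ∑ A, ∑ B, (m ^ 2) ^ (2 * K' + 1) *
        (if graphDist A.1 B.1 ≤ 2 * K' + 1 then (f A - f B) ^ 2 else 0) := by
    rw [← hsum fun A => _]
    refine sum_le_sum fun i _ => ?_
    rw [← sum_fiberwise_of_maps_to (s := univ) (t := univ) (g := fun j : Lifted n ℓ u => j.1)
      fun _ _ => mem_univ _]
    refine sum_le_sum fun B _ => ?_
    by_cases hB : graphDist i.1.1 B.1 ≤ 2 * K' + 1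
    · rw [if_pos hB, ← sum_filter]
      have h1 : ∀ j ∈ ((univ.filter fun j : Lifted n ℓ u => j.1 = B).filter
          fun j => hammingDist i.toFun j.toFun ≤ 2 * K' + 1), (f i.1 - f j.1) ^ 2 =
          (f i.1 - f B) ^ 2 := by
        intro j hj
        rw [(mem_filter.1 (mem_filter.1 hj).1).2]
      rw [sum_congr rfl h1, sum_const, nsmul_eq_mul]
      refine mul_le_mul_of_nonneg_right ?_ (sq_nonneg _)
      have h2 := card_hammingBall_le i.toFun (2 * K' + 1)
      have h3 : ((univ.filter fun j : Lifted n ℓ u => j.1 = B).filter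
          fun j => hammingDist i.toFun j.toFun ≤ 2 * K' + 1).card ≤
          (univ.filter fun Z => hammingDist Z i.toFun ≤ 2 * K' + 1).card := by
        refine card_le_card_of_injOn Lifted.toFun ?_ (Lifted.toFun_injective.injOn)
        intro j hj
        have := (mem_filter.1 (mem_coe.1 hj)).2
        rw [hammingDist_comm] at this
        exact mem_coe.2 (mem_filter.2 ⟨mem_univ _, this⟩)
      have h4 : (((univ.filter fun j : Lifted n ℓ u => j.1 = B).filter
          fun j => hammingDist i.toFun j.toFun ≤ 2 * K' + 1).card : ℝ) ≤
          (((Fintype.card (Node n ℓ) * Fintype.card (Node n ℓ)) ^ (2 * K' + 1) : ℕ) : ℝ) :=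
        Nat.cast_le.2 (h3.trans h2)
      refine h4.trans (le_of_eq ?_)
      push_cast
      rw [pow_two]
    · rw [if_neg hB, mul_zero]
      refine (sum_eq_zero fun j hj => ?_).le
      rw [if_neg]
      intro h
      refine hB ?_
      rw [← (mem_filter.1 hj).2]
      exact (i.graphDist_le j).trans h
  rw [hleft, hcard] at hflow
  have hm0 : 0 ≤ m := Nat.cast_nonneg _
  have h5 := hflow.trans (mul_le_mul_of_nonneg_left hright (by positivity))
  simp only [← mul_sum] at h5
  have e2 : 2 * K' + 1 = 8 * K + 25 := by omega
  rw [e2] at h5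
  set T := ∑ A : IntervalGraph n ℓ u, ∑ B : IntervalGraph n ℓ u, if graphDist A.1 B.1 ≤ 8 * K + 25 then (f A - f B) ^ 2 else 0 with hT
  refine le_of_mul_le_mul_left (a := (N : ℝ) * N) ?_ (by positivity)
  calc (N : ℝ) * N * ∑ A, ∑ B, (f A - f B) ^ 2 = N * (N * ∑ A, ∑ B, (f A - f B) ^ 2) := by ring
    _ ≤ _ := h5
    _ = N * N * (m ^ (32 * K + 100) * Fintype.card (IntervalGraph n ℓ u) * T) := by
      rw [← pow_mul, ← pow_mul]
      ring

section reversible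

theorem swap_pairs {α : Type*} {E E' : Set α} {a b c d : α} (ha : a ∈ E) (hb : b ∈ E)
    (hc : c ∉ E) (hd : d ∉ E) (h : E' = (E \ {a, b}) ∪ {c, d}) :
    c ∈ E' ∧ d ∈ E' ∧ a ∉ E' ∧ b ∉ E' ∧ E = (E' \ {c, d}) ∪ {a, b} := by
  have hac : a ≠ c := fun h => hc (h ▸ ha)
  have had : a ≠ d := fun h => hd (h ▸ ha)
  have hbc : b ≠ c := fun h => hc (h ▸ hb)
  have hbd : b ≠ d := fun h => hd (h ▸ hb)
  subst h
  refine ⟨by simp, by simp, by simp [hac, had], by simp [hbc, hbd], ?_⟩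
  ext e
  simp only [Set.mem_union, Set.mem_sdiff, Set.mem_insert_iff, Set.mem_singleton_iff]
  constructor
  · intro he
    have h1 : e ≠ c := fun h => hc (h ▸ he)
    have h2 : e ≠ d := fun h => hd (h ▸ he)
    tauto
  · rintro (⟨h1, h2⟩ | rfl | rfl)
    · tauto
    · exact ha
    · exact hb

theorem switchCount_le {n : ℕ} (G G' : SimpleGraph (Fin n)) :
    switchCount G G' ≤ switchCount G' G := by
  unfold switchCount
  refine Set.ncard_le_ncard_of_injOn (fun t => (t.1, t.2.2.2, t.2.2.1, t.2.1)) ?_ ?_ (Set.toFinite _)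
  · rintro ⟨v, w, x, y⟩ ⟨h1, h2, h3, h4, h5⟩
    dsimp only at h1 h2 h3 h4 h5
    obtain ⟨g1, g2, g3, g4, g5⟩ := swap_pairs (E := G.edgeSet) (E' := G'.edgeSet)
      (a := s(v, w)) (b := s(x, y)) (c := s(v, y)) (d := s(w, x)) h1 h2 h3 h4 h5
    refine ⟨g1, G'.adj_symm g2, g3, fun h => g4 (G'.adj_symm h), ?_⟩
    dsimp only
    rw [Sym2.eq_swap (a := x) (b := w), Sym2.eq_swap (a := y) (b := x)]
    exact g5
  · rintro ⟨v, w, x, y⟩ - ⟨v', w', x', y'⟩ - h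
    simp only [Prod.mk.injEq] at h ⊢
    tauto

theorem hingeCount_le {n : ℕ} (G G' : SimpleGraph (Fin n)) :
    hingeCount G G' ≤ hingeCount G' G := by
  unfold hingeCount
  refine Set.ncard_le_ncard_of_injOn (fun t => (t.2.2, t.2.1, t.1)) ?_ ?_ (Set.toFinite _)
  · rintro ⟨v, w, x⟩ ⟨h1, h2, h3⟩
    dsimp only at h1 h2 h3
    obtain ⟨g1, -, g3, -, g5⟩ := swap_pairs (E := G.edgeSet) (E' := G'.edgeSet)
      (a := s(v, w)) (b := s(v, w)) (c := s(w, x)) (d := s(w, x)) h1 h1 h2 h2 (by simpa using h3)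
    refine ⟨G'.adj_symm g1, fun h => g3 (G'.adj_symm h), ?_⟩
    dsimp only
    rw [Sym2.eq_swap (a := x) (b := w), Sym2.eq_swap (a := w) (b := v)]
    simpa using g5
  · rintro ⟨v, w, x⟩ - ⟨v', w', x'⟩ - h
    simp only [Prod.mk.injEq] at h ⊢
    tauto

theorem addDelCount_le {n : ℕ} (G G' : SimpleGraph (Fin n)) :
    addDelCount G G' ≤ addDelCount G' G := by
  unfold addDelCount
  refine Set.ncard_le_ncard (fun t ht => ?_) (Set.toFinite _)
  refine ⟨ht.1, ?_⟩
  rw [ht.2, symmDiff_symmDiff_cancel_right]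

theorem switchCount_comm {n : ℕ} (G G' : SimpleGraph (Fin n)) :
    switchCount G G' = switchCount G' G :=
  le_antisymm (switchCount_le _ _) (switchCount_le _ _)

theorem hingeCount_comm {n : ℕ} (G G' : SimpleGraph (Fin n)) :
    hingeCount G G' = hingeCount G' G :=
  le_antisymm (hingeCount_le _ _) (hingeCount_le _ _)

theorem addDelCount_comm {n : ℕ} (G G' : SimpleGraph (Fin n)) :
    addDelCount G G' = addDelCount G' G :=
  le_antisymm (addDelCount_le _ _) (addDelCount_le _ _)

theorem Move.symm {n : ℕ} {A B : SimpleGraph (Fin n)} (h : Move A B) : Move B A := by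
  unfold Move at h ⊢
  rwa [switchCount_comm, hingeCount_comm, addDelCount_comm]

theorem diMatrix_comm {n : ℕ} {ℓ u : Fin n → ℕ} (A B : IntervalGraph n ℓ u) :
    diMatrix n ℓ u A B = diMatrix n ℓ u B A := by
  unfold diMatrix
  by_cases h : A = B
  · rw [h]
  · simp only [if_neg h, if_neg (Ne.symm h)]
    rw [switchCount_comm, hingeCount_comm, addDelCount_comm]

theorem sum_diMatrix {n : ℕ} {ℓ u : Fin n → ℕ} [Fintype (IntervalGraph n ℓ u)]
    (A : IntervalGraph n ℓ u) : ∑ B, diMatrix n ℓ u A B = 1 := by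
  classical
  have hd : diMatrix n ℓ u A A = 1 - ∑ B ∈ univ.erase A, diMatrix n ℓ u A B := by
    unfold diMatrix
    simp only [if_true]
    congr 1
    refine sum_congr (by ext; simp) fun B hB => ?_
    rw [if_neg (ne_of_mem_erase hB).symm]
  rw [← add_sum_erase univ _ (mem_univ A), hd, sub_add_cancel]

theorem diMatrix_nonneg {n : ℕ} {ℓ u : Fin n → ℕ} {A B : IntervalGraph n ℓ u} (h : A ≠ B) :
    0 ≤ diMatrix n ℓ u A B := by
  unfold diMatrix
  simp only [if_neg h]
  positivity

theorem Move.diMatrix_ge {n : ℕ} {ℓ u : Fin n → ℕ} {A B : IntervalGraph n ℓ u} (hn : 1 ≤ n)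
    (hAB : A ≠ B) (h : Move A.1 B.1) : 1 / (6 * (n : ℝ) ^ 4) ≤ diMatrix n ℓ u A B := by
  unfold diMatrix
  simp only [if_neg hAB]
  have hn' : (1 : ℝ) ≤ n := by exact_mod_cast hn
  have h1 : 1 / (6 * (n : ℝ) ^ 4) ≤ 1 / (6 * (n : ℝ) ^ 3) := by
    gcongr
    norm_num
  have h2 : 1 / (6 * (n : ℝ) ^ 4) ≤ 1 / (6 * (n : ℝ) ^ 2) := by
    gcongr
    norm_num
  have hc : (1 : ℝ) ≤ switchCount A.1 B.1 + hingeCount A.1 B.1 + addDelCount A.1 B.1 := by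
    exact_mod_cast h
  have h0 : 0 ≤ 1 / (6 * (n : ℝ) ^ 4) := by positivity
  calc 1 / (6 * (n : ℝ) ^ 4) ≤ 1 / (6 * (n : ℝ) ^ 4) *
        (switchCount A.1 B.1 + hingeCount A.1 B.1 + addDelCount A.1 B.1) :=
        le_mul_of_one_le_right h0 hc
    _ = 1 / (6 * (n : ℝ) ^ 4) * switchCount A.1 B.1 + 1 / (6 * (n : ℝ) ^ 4) * hingeCount A.1 B.1 +
        1 / (6 * (n : ℝ) ^ 4) * addDelCount A.1 B.1 := by ring
    _ ≤ _ := by gcongr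

/-- The Dirichlet form of an eigenvector of a symmetric stochastic matrix. -/
theorem sum_mul_sq_sub_of_eigen {S : Type*} [Fintype S] {P : S → S → ℝ}
    (hP : ∀ a b, P a b = P b a) (h1 : ∀ a, ∑ b, P a b = 1) {lam : ℝ} {f : S → ℝ}
    (hf : ∀ a, ∑ b, P a b * f b = lam * f a) :
    ∑ a, ∑ b, P a b * (f a - f b) ^ 2 = 2 * (1 - lam) * ∑ a, f a ^ 2 := by
  have e1 : ∑ a, ∑ b, P a b * f a ^ 2 = ∑ a, f a ^ 2 := by
    refine sum_congr rfl fun a _ => ?_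
    rw [← sum_mul, h1, one_mul]
  have e2 : ∑ a, ∑ b, P a b * f b ^ 2 = ∑ a, f a ^ 2 := by
    rw [sum_comm, ← e1]
    exact sum_congr rfl fun a _ => sum_congr rfl fun b _ => by rw [hP]
  have e3 : ∑ a, ∑ b, P a b * (f a * f b) = lam * ∑ a, f a ^ 2 := by
    rw [mul_sum]
    refine sum_congr rfl fun a _ => ?_
    rw [show lam * f a ^ 2 = f a * (lam * f a) by ring, ← hf, mul_sum]
    exact sum_congr rfl fun b _ => by ring
  have : ∑ a, ∑ b, P a b * (f a - f b) ^ 2 = ∑ a, ∑ b, P a b * f a ^ 2 +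
      ∑ a, ∑ b, P a b * f b ^ 2 - 2 * ∑ a, ∑ b, P a b * (f a * f b) := by
    simp only [mul_sum, ← sum_add_distrib, ← sum_sub_distrib]
    exact sum_congr rfl fun a _ => sum_congr rfl fun b _ => by ring
  rw [this, e1, e2, e3]
  ring

theorem sum_eq_zero_of_eigen {S : Type*} [Fintype S] {P : S → S → ℝ}
    (hP : ∀ a b, P a b = P b a) (h1 : ∀ a, ∑ b, P a b = 1) {lam : ℝ} (hlam : lam ≠ 1) {f : S → ℝ}
    (hf : ∀ a, ∑ b, P a b * f b = lam * f a) : ∑ a, f a = 0 := by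
  have : ∑ a, ∑ b, P a b * f b = ∑ b, f b := by
    rw [sum_comm]
    refine sum_congr rfl fun b _ => ?_
    rw [← sum_mul, sum_congr rfl fun a _ => hP a b, h1, one_mul]
  rw [sum_congr rfl fun a _ => hf a, ← mul_sum] at this
  have h : (lam - 1) * ∑ a, f a = 0 := by linarith
  exact (mul_eq_zero.1 h).resolve_left (sub_ne_zero.2 hlam)

theorem sum_sum_sq_sub {S : Type*} [Fintype S] {f : S → ℝ} (hf : ∑ a, f a = 0) :
    ∑ a, ∑ b, (f a - f b) ^ 2 = 2 * Fintype.card S * ∑ a, f a ^ 2 := by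
  have : ∀ a, ∑ b, (f a - f b) ^ 2 = Fintype.card S * f a ^ 2 + ∑ b, f b ^ 2 := by
    intro a
    have e : ∀ b, (f a - f b) ^ 2 = f a ^ 2 + f b ^ 2 - 2 * f a * f b := fun b => by ring
    simp only [e, sum_sub_distrib, sum_add_distrib, ← mul_sum, hf, sum_const, card_univ,
      nsmul_eq_mul]
    ring
  simp only [this, sum_add_distrib, ← mul_sum, sum_const, card_univ, nsmul_eq_mul]
  ring

end reversible

section comparison

theorem card_intervalGraph_dist_le {n : ℕ} [NeZero n] {ℓ u : Fin n → ℕ}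
    [Fintype (IntervalGraph n ℓ u)] (B : SimpleGraph (Fin n)) (k : ℕ) :
    (univ.filter fun A : IntervalGraph n ℓ u => graphDist A.1 B ≤ k).card ≤ (2 * n ^ 2) ^ k := by
  classical
  have h := card_hammingBall_le (adjFun B) k
  rw [Fintype.card_prod, Fintype.card_fin, Fintype.card_prop] at h
  rw [show 2 * n ^ 2 = n * n * 2 by ring]
  refine le_trans (card_le_card_of_injOn (fun A => adjFun A.1) ?_ ?_) h
  · intro A hA
    have := (mem_filter.1 (mem_coe.1 hA)).2
    refine mem_coe.2 (mem_filter.2 ⟨mem_univ _, ?_⟩)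
    convert this using 1
    unfold graphDist
    convert rfl
  · intro A _ A' _ h
    exact Subtype.ext (adjFun_injective h)

open scoped Classical in
/-- Dirichlet form of the graph of pairs at distance at most `k`. -/
noncomputable def distForm {n : ℕ} {ℓ u : Fin n → ℕ} [Fintype (IntervalGraph n ℓ u)] (k : ℕ)
    (f : IntervalGraph n ℓ u → ℝ) : ℝ :=
  ∑ A, ∑ B, if graphDist A.1 B.1 ≤ k then (f A - f B) ^ 2 else 0

open scoped Classical in
/-- Dirichlet form of the graph of moves. -/
noncomputable def moveForm {n : ℕ} {ℓ u : Fin n → ℕ} [Fintype (IntervalGraph n ℓ u)]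
    (f : IntervalGraph n ℓ u → ℝ) : ℝ :=
  ∑ A, ∑ B, if Move A.1 B.1 then (f A - f B) ^ 2 else 0

variable {n : ℕ} {ℓ u : Fin n → ℕ} [Fintype (IntervalGraph n ℓ u)]

theorem moveForm_nonneg (f : IntervalGraph n ℓ u → ℝ) : 0 ≤ moveForm f :=
  sum_nonneg fun _ _ => sum_nonneg fun _ _ => by split_ifs <;> positivity

theorem distForm_succ_le [NeZero n] (hlu : ∀ i, u i ≤ ℓ i + 1) (k : ℕ)
    (f : IntervalGraph n ℓ u → ℝ) :
    distForm (k + 1) f ≤ 4 * (2 * (n : ℝ) ^ 2) ^ (2 * (k + 1)) * (moveForm f + distForm k f) := by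
  classical
  -- the contribution of the triples `A, C, B` with a move from `A` to `C`
  let w : IntervalGraph n ℓ u → IntervalGraph n ℓ u → IntervalGraph n ℓ u → ℝ := fun A C B =>
    if Move A.1 C.1 ∧ graphDist A.1 C.1 ≤ 2 * (k + 1) ∧ graphDist C.1 B.1 ≤ k then
      2 * (f A - f C) ^ 2 + 2 * (f C - f B) ^ 2 else 0
  have hw : ∀ A C B, 0 ≤ w A C B := fun A C B => by
    dsimp only [w]
    split_ifs <;> positivity
  have hsq : ∀ x y z : ℝ, (x - z) ^ 2 ≤ 2 * (x - y) ^ 2 + 2 * (y - z) ^ 2 := fun x y z => by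
    nlinarith [sq_nonneg (x - 2 * y + z)]
  have hpt : ∀ A B : IntervalGraph n ℓ u,
      (if graphDist A.1 B.1 ≤ k + 1 then (f A - f B) ^ 2 else 0) ≤
        ∑ C, w A C B + ∑ C, w B C A := by
    intro A B
    by_cases hd : graphDist A.1 B.1 ≤ k + 1
    swap
    · rw [if_neg hd]
      exact add_nonneg (sum_nonneg fun _ _ => hw _ _ _) (sum_nonneg fun _ _ => hw _ _ _)
    rw [if_pos hd]
    by_cases hAB : A = B
    · subst hAB
      rw [sub_self, zero_pow two_ne_zero]
      exact add_nonneg (sum_nonneg fun _ _ => hw _ _ _) (sum_nonneg fun _ _ => hw _ _ _)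
    rcases reducible_of_ne hlu A.2 B.2 (fun h => hAB (Subtype.ext h)) with
      ⟨C, hC, hm, hlt⟩ | ⟨C, hC, hm, hlt⟩
    · refine le_trans ?_ (le_add_of_nonneg_right (sum_nonneg fun _ _ => hw _ _ _))
      refine le_trans ?_ (single_le_sum (fun C _ => hw A C B) (mem_univ ⟨C, hC⟩))
      have h1 := graphDist_triangle A.1 B.1 C
      have h2 := graphDist_comm C B.1
      dsimp only [w]
      rw [if_pos ⟨hm, by omega, by omega⟩]
      exact hsq _ _ _
    · refine le_trans ?_ (le_add_of_nonneg_left (sum_nonneg fun _ _ => hw _ _ _))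
      refine le_trans ?_ (single_le_sum (fun C _ => hw B C A) (mem_univ ⟨C, hC⟩))
      have h1 := graphDist_triangle B.1 A.1 C
      have h2 := graphDist_comm B.1 A.1
      have h3 := graphDist_comm C A.1
      dsimp only [w]
      rw [if_pos ⟨hm, by omega, by omega⟩, ← neg_sub, neg_sq]
      exact hsq _ _ _
  set b : ℝ := (2 * (n : ℝ) ^ 2) ^ (2 * (k + 1)) with hb
  have hn1 : 1 ≤ 2 * n ^ 2 := by
    have := Nat.pos_of_ne_zero (NeZero.ne n)
    have := Nat.pow_pos (n := 2) this
    omega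
  have hball : ∀ (B : IntervalGraph n ℓ u) (j : ℕ), j ≤ 2 * (k + 1) →
      ((univ.filter fun A : IntervalGraph n ℓ u => graphDist A.1 B.1 ≤ j).card : ℝ) ≤ b := by
    intro B j hj
    have := (card_intervalGraph_dist_le (ℓ := ℓ) (u := u) B.1 j).trans
      (Nat.pow_le_pow_right hn1 hj)
    have h' : ((univ.filter fun A : IntervalGraph n ℓ u => graphDist A.1 B.1 ≤ j).card : ℝ) ≤
      ((2 * n ^ 2) ^ (2 * (k + 1)) : ℕ) := Nat.cast_le.2 this
    push_cast at h'
    exact h'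
  have hwsplit : ∀ A C B, w A C B ≤
      (if graphDist B.1 C.1 ≤ k then (if Move A.1 C.1 then 2 * (f A - f C) ^ 2 else 0) else 0) +
      (if graphDist A.1 C.1 ≤ 2 * (k + 1) then
        (if graphDist C.1 B.1 ≤ k then 2 * (f C - f B) ^ 2 else 0) else 0) := by
    intro A C B
    have h3 := graphDist_comm C.1 B.1
    dsimp only [w]
    split_ifs <;> first | positivity | (exfalso; omega) | simp_all
  have hsumw : ∑ A, ∑ B, ∑ C, w A C B ≤ 2 * b * (moveForm f + distForm k f) := by
    have e1 : ∑ A : IntervalGraph n ℓ u, ∑ B : IntervalGraph n ℓ u, ∑ C : IntervalGraph n ℓ u,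
        (if graphDist B.1 C.1 ≤ k then (if Move A.1 C.1 then 2 * (f A - f C) ^ 2 else 0) else 0) ≤
        2 * b * moveForm f := by
      unfold moveForm
      rw [mul_sum]
      refine sum_le_sum fun A _ => ?_
      rw [sum_comm, mul_sum]
      refine sum_le_sum fun C _ => ?_
      rw [← sum_filter, sum_const, nsmul_eq_mul]
      have := hball C k (by omega)
      split_ifs
      · nlinarith [sq_nonneg (f A - f C)]
      · simp
    have e2 : ∑ A : IntervalGraph n ℓ u, ∑ B : IntervalGraph n ℓ u, ∑ C : IntervalGraph n ℓ u,
        (if graphDist A.1 C.1 ≤ 2 * (k + 1) then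
          (if graphDist C.1 B.1 ≤ k then 2 * (f C - f B) ^ 2 else 0) else 0) ≤
        2 * b * distForm k f := by
      unfold distForm
      rw [sum_comm, mul_sum]
      simp only [mul_sum]
      rw [sum_comm (f := fun A B => 2 * b * (if graphDist A.1 B.1 ≤ k then
        (f A - f B) ^ 2 else 0))]
      refine sum_le_sum fun B _ => ?_
      rw [sum_comm]
      refine sum_le_sum fun C _ => ?_
      rw [← sum_filter, sum_const, nsmul_eq_mul]
      have := hball C _ le_rfl
      split_ifs
      · nlinarith [sq_nonneg (f C - f B)]
      · simp
    calc ∑ A, ∑ B, ∑ C, w A C B ≤ _ :=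
          sum_le_sum fun A _ => sum_le_sum fun B _ => sum_le_sum fun C _ => hwsplit A C B
      _ ≤ 2 * b * moveForm f + 2 * b * distForm k f := by
          simp only [sum_add_distrib]
          exact add_le_add e1 e2
      _ = _ := by ring
  calc distForm (k + 1) f ≤ ∑ A, ∑ B, (∑ C, w A C B + ∑ C, w B C A) :=
        sum_le_sum fun A _ => sum_le_sum fun B _ => hpt A B
    _ = ∑ A, ∑ B, ∑ C, w A C B + ∑ A, ∑ B, ∑ C, w A C B := by
        simp only [sum_add_distrib]
        rw [sum_comm (f := fun A B => ∑ C, w B C A)]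
    _ ≤ 4 * b * (moveForm f + distForm k f) := by linarith

theorem distForm_le [NeZero n] (hlu : ∀ i, u i ≤ ℓ i + 1) (k : ℕ) (f : IntervalGraph n ℓ u → ℝ) :
    distForm k f ≤ (8 * (2 * (n : ℝ) ^ 2) ^ (2 * k)) ^ k * moveForm f := by
  have hn : (1 : ℝ) ≤ n := by exact_mod_cast Nat.pos_of_ne_zero (NeZero.ne n)
  have hb : (1 : ℝ) ≤ 2 * (n : ℝ) ^ 2 := by nlinarith
  have hM := moveForm_nonneg f
  induction k with
  | zero =>
    have : distForm 0 f = 0 := by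
      refine sum_eq_zero fun A _ => sum_eq_zero fun B _ => ?_
      split_ifs with h
      · rw [Nat.le_zero, graphDist_eq_zero] at h
        rw [Subtype.ext h, sub_self, zero_pow two_ne_zero]
      · rfl
    rw [this, pow_zero, one_mul]
    exact hM
  | succ k ih =>
    set c : ℝ := (8 * (2 * (n : ℝ) ^ 2) ^ (2 * k)) ^ k with hc
    set b : ℝ := (2 * (n : ℝ) ^ 2) ^ (2 * (k + 1)) with hbdef
    have hb0 : 0 ≤ b := by positivity
    have hc1 : 1 ≤ c := one_le_pow₀ (by
      have := one_le_pow₀ hb (n := 2 * k)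
      linarith)
    have hcb : c ≤ (8 * b) ^ k := by
      refine pow_le_pow_left₀ (by positivity) ?_ k
      exact mul_le_mul_of_nonneg_left (pow_le_pow_right₀ hb (by omega)) (by norm_num)
    calc distForm (k + 1) f ≤ 4 * b * (moveForm f + distForm k f) := distForm_succ_le hlu k f
      _ ≤ 4 * b * (c * moveForm f + c * moveForm f) := by
          gcongr
          exact le_mul_of_one_le_left hM hc1
      _ = 8 * b * (c * moveForm f) := by ring
      _ ≤ 8 * b * ((8 * b) ^ k * moveForm f) := by gcongr
      _ = (8 * b) ^ (k + 1) * moveForm f := by ring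

theorem moveForm_le (hn : 1 ≤ n) (f : IntervalGraph n ℓ u → ℝ) :
    moveForm f ≤ 6 * (n : ℝ) ^ 4 * ∑ A, ∑ B, diMatrix n ℓ u A B * (f A - f B) ^ 2 := by
  unfold moveForm
  have hn' : (0 : ℝ) < n := by exact_mod_cast hn
  rw [mul_sum]
  refine sum_le_sum fun A _ => ?_
  rw [mul_sum]
  refine sum_le_sum fun B _ => ?_
  by_cases hAB : A = B
  · subst hAB
    simp
  split_ifs with h
  · have h1 := h.diMatrix_ge hn hAB
    rw [div_le_iff₀ (by positivity)] at h1
    rw [← mul_assoc]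
    exact le_mul_of_one_le_left (sq_nonneg _) (by linarith)
  · have := diMatrix_nonneg hAB
    positivity

/-- The spectral gap of the chain, given that near-members can be repaired. -/
theorem one_le_of_isEigenPair [NeZero n] (hlu : ∀ i, ℓ i ≤ u i ∧ u i ≤ ℓ i + 1)
    (hln : ∀ i, ℓ i + 1 ≤ n) {K : ℕ} (hrep : Repairable n ℓ u 4 K) {lam : ℝ}
    {f : IntervalGraph n ℓ u → ℝ} (hf : f ≠ 0) (he : IsEigenPair (diMatrix n ℓ u) lam f)
    (hlam : lam ≠ 1) :
    1 ≤ (Fintype.card (Node n ℓ) : ℝ) ^ (32 * K + 100) *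
      (8 * (2 * (n : ℝ) ^ 2) ^ (2 * (8 * K + 25))) ^ (8 * K + 25) * (6 * (n : ℝ) ^ 4) *
        (1 - lam) := by
  classical
  have he' : ∀ A, ∑ B, diMatrix n ℓ u A B * f B = lam * f A := by
    intro A
    have := congrFun he A
    simp only [Matrix.mulVec, dotProduct, Pi.smul_apply, smul_eq_mul] at this
    rw [← this]
    exact sum_congr (by ext; simp) fun _ _ => rfl
  have hP := fun A B => diMatrix_comm (ℓ := ℓ) (u := u) A B
  have h1 := fun A => sum_diMatrix (ℓ := ℓ) (u := u) A
  have hpos : 0 < ∑ A, f A ^ 2 := by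
    obtain ⟨A, hA⟩ := Function.ne_iff.1 hf
    refine sum_pos' (fun _ _ => sq_nonneg _) ⟨A, mem_univ _, ?_⟩
    have : f A ≠ 0 := hA
    positivity
  have hc : (0 : ℝ) < Fintype.card (IntervalGraph n ℓ u) := by
    obtain ⟨A, -⟩ := Function.ne_iff.1 hf
    exact Nat.cast_pos.2 (Fintype.card_pos_iff.2 ⟨A⟩)
  have i1 := sum_sq_sub_le_of_repairable hlu hln hrep f
  rw [sum_sum_sq_sub (sum_eq_zero_of_eigen hP h1 hlam he')] at i1
  have i2 : _ ≤ _ := distForm_le (fun i => (hlu i).2) (8 * K + 25) f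
  have i3 := moveForm_le (Nat.pos_of_ne_zero (NeZero.ne n)) f
  rw [sum_mul_sq_sub_of_eigen hP h1 he'] at i3
  set N : ℝ := (Fintype.card (IntervalGraph n ℓ u) : ℝ) with hN
  set m : ℝ := (Fintype.card (Node n ℓ) : ℝ) ^ (32 * K + 100) with hm
  set c : ℝ := (8 * (2 * (n : ℝ) ^ 2) ^ (2 * (8 * K + 25))) ^ (8 * K + 25) with hcdef
  set s := ∑ A, f A ^ 2 with hs
  have hm0 : 0 ≤ m := by positivity
  have hc0 : 0 ≤ c := pow_nonneg (mul_nonneg (by norm_num) (pow_nonneg (by positivity) _)) _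
  have hs0 : 0 < 2 * N * s := mul_pos (mul_pos two_pos hc) hpos
  have hmN : 0 ≤ m * N := mul_nonneg hm0 hc.le
  have i4 : 2 * N * s ≤ m * N * (c * (6 * (n : ℝ) ^ 4 * (2 * (1 - lam) * s))) := by
    refine i1.trans (mul_le_mul_of_nonneg_left ?_ hmN)
    refine le_trans (le_of_eq ?_) (i2.trans (mul_le_mul_of_nonneg_left i3 hc0))
    unfold distForm
    exact sum_congr rfl fun A _ => sum_congr rfl fun B _ => by congr
  refine le_of_mul_le_mul_left (a := 2 * N * s) ?_ hs0
  linarith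

end comparison

theorem exists_repairCond {ρ : ℝ} (hρ0 : 0 < ρ) (hρ : ρ < 1) :
    ∃ n₀ : ℕ, ∀ n : ℕ, n₀ ≤ n → ∀ r s : ℝ, 0 ≤ r → r ≤ (1 - ρ) * n → 0 ≤ s → s ≤ √r →
      RepairCond n (⌈r - s⌉₊ - 10) ⌊r + s⌋₊ 10 := by
  set T : ℝ := 33 / ρ with hT
  set M : ℕ := ⌈T ^ 2 + T⌉₊ with hM
  refine ⟨(M + 1) * M + M + 12, fun n hn r s hr hrn hs0 hs => ?_⟩
  set t : ℝ := √r with ht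
  have ht0 : 0 ≤ t := Real.sqrt_nonneg r
  have htt : t ^ 2 = r := Real.sq_sqrt hr
  have hρn : 0 ≤ ρ * n := by positivity
  have hrs : 0 ≤ r + s := add_nonneg hr hs0
  have hU : (⌊r + s⌋₊ : ℝ) ≤ r + s := Nat.floor_le hrs
  rcases lt_or_ge t T with hlt | hge
  · right
    have hUM : ⌊r + s⌋₊ ≤ M := by
      refine Nat.cast_le (α := ℝ) |>.1 (hU.trans (le_trans ?_ (Nat.le_ceil _)))
      nlinarith
    have : (⌊r + s⌋₊ + 1) * ⌊r + s⌋₊ ≤ (M + 1) * M := by gcongr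
    omega
  · left
    have hTρ : ρ * T = 33 := by
      rw [hT]
      field_simp
    have hT33 : 33 ≤ T := by
      rw [hT, le_div_iff₀ hρ0]
      linarith
    have hρt : 33 ≤ ρ * t := by
      rw [← hTρ]
      gcongr
    have hL : r - s - 10 ≤ ((⌈r - s⌉₊ - 10 : ℕ) : ℝ) := by
      have h1 := Nat.le_ceil (r - s)
      have h2 : ((⌈r - s⌉₊ : ℕ) : ℝ) ≤ ((⌈r - s⌉₊ - 10 : ℕ) : ℝ) + 10 := by
        exact_mod_cast (by omega : ⌈r - s⌉₊ ≤ ⌈r - s⌉₊ - 10 + 10)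
      linarith
    set L : ℕ := ⌈r - s⌉₊ - 10 with hLdef
    set U : ℕ := ⌊r + s⌋₊ with hUdef
    have hrt : ρ * r = ρ * t * t := by rw [← htt]; ring
    have hnr : ρ * r ≤ ρ * n := by nlinarith
    have hbig : 3 + s ≤ ρ * n / 2 := by nlinarith
    have hUL : ((U - L + 1 : ℕ) : ℝ) ≤ 2 * s + 11 := by
      rcases le_total L U with h | h
      · push_cast [Nat.cast_sub h]
        linarith
      · rw [Nat.sub_eq_zero_of_le h]
        push_cast
        linarith
    have hnU : ρ * n / 2 ≤ ((n - 3 - U : ℕ) : ℝ) := by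
      have h2 : (n : ℝ) ≤ ((n - 3 - U : ℕ) : ℝ) + (3 + U) := by
        exact_mod_cast (by omega : n ≤ n - 3 - U + (3 + U))
      linarith
    have hn0 : (0 : ℝ) < n := by
      have : 0 < n := by omega
      exact_mod_cast this
    have hLt : t ^ 2 / 2 ≤ (L : ℝ) := by nlinarith
    have hkey : 2 * s + 11 < ρ / 2 * (t ^ 2 / 2) := by nlinarith
    have : (n : ℝ) * ((U - L + 1 : ℕ) : ℝ) < ((n - 3 - U : ℕ) : ℝ) * (L : ℝ) :=
      calc (n : ℝ) * ((U - L + 1 : ℕ) : ℝ) ≤ n * (2 * s + 11) := by gcongr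
        _ < n * (ρ / 2 * (t ^ 2 / 2)) := by gcongr
        _ = ρ * n / 2 * (t ^ 2 / 2) := by ring
        _ ≤ ((n - 3 - U : ℕ) : ℝ) * (L : ℝ) := by gcongr
    exact_mod_cast this

theorem card_node_le {n : ℕ} (hn : 1 ≤ n) (ℓ : Fin n → ℕ) :
    Fintype.card (Node n ℓ) ≤ 3 * n ^ 2 := by
  have h : ∑ v : Fin n, (n - 1 - ℓ v) ≤ n * n := by
    refine (sum_le_card_nsmul univ _ n fun v _ => by omega).trans ?_
    simp
  simp only [Node, Fintype.card_sum, Fintype.card_prod, Fintype.card_option, Fintype.card_fin,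
    Fintype.card_sigma]
  nlinarith

theorem le_one_sub_of_one_le {n c : ℝ} {k : ℕ} {x lam : ℝ} (hn : 0 < n) (hc : 0 < c)
    (h : 1 ≤ x * (1 - lam)) (hx0 : 0 < x) (hx : x ≤ c * n ^ k) :
    lam ≤ 1 - 1 / (c * n ^ k) := by
  have hl : 0 < 1 - lam := pos_of_mul_pos_right (zero_lt_one.trans_le h) hx0.le
  have : 1 / (c * n ^ k) ≤ 1 - lam := by
    rw [div_le_iff₀ (by positivity), mul_comm]
    exact h.trans (mul_le_mul_of_nonneg_right hx hl.le)
  linarith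

theorem mixing_bound_le {n N : ℝ} (hN0 : 0 ≤ N) (hN : N ≤ 3 * n ^ 2) (p q : ℕ) :
    N ^ p * (8 * (2 * n ^ 2) ^ (2 * q)) ^ q * (6 * n ^ 4) ≤
      (3 ^ p * (8 * 2 ^ (2 * q)) ^ q * 6) * n ^ (2 * p + 4 * q * q + 4) := by
  calc N ^ p * (8 * (2 * n ^ 2) ^ (2 * q)) ^ q * (6 * n ^ 4) ≤
      (3 * n ^ 2) ^ p * (8 * (2 * n ^ 2) ^ (2 * q)) ^ q * (6 * n ^ 4) := by gcongr
    _ = _ := by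
      simp only [mul_pow, ← pow_mul, pow_add]
      ring

/-- The constants `c, k` of the spectral gap when defects can be repaired within distance `K`. -/
theorem exists_gap_of_repairable (K : ℕ) :
    ∃ c k : ℕ, 0 < c ∧ ∀ n : ℕ, 1 ≤ n → ∀ ℓ u : Fin n → ℕ, (∀ i, ℓ i ≤ u i ∧ u i ≤ ℓ i + 1) →
      (∀ G₀, memGlu n ℓ u G₀ → Repairable n ℓ u 4 K) → ∀ (lam : ℝ) (v : IntervalGraph n ℓ u → ℝ),
        v ≠ 0 → IsEigenPair (diMatrix n ℓ u) lam v → lam ≠ 1 →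
          lam ≤ 1 - 1 / ((c : ℝ) * (n : ℝ) ^ k) := by
  generalize hp : 32 * K + 100 = p
  generalize hq : 8 * K + 25 = q
  refine ⟨3 ^ p * (8 * 2 ^ (2 * q)) ^ q * 6, 2 * p + 4 * q * q + 4, by positivity,
    fun n hn ℓ u hlu hrep lam v hv he hlam => ?_⟩
  classical
  have : NeZero n := ⟨by omega⟩
  have : Fintype (IntervalGraph n ℓ u) := Fintype.ofFinite _
  obtain ⟨⟨G₀, hG₀⟩, -⟩ := Function.ne_iff.1 hv
  have hln : ∀ i, ℓ i + 1 ≤ n := fun i => by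
    have := card_nonNbr G₀ i
    have := (hG₀ i).1
    omega
  have h := one_le_of_isEigenPair hlu hln (hrep G₀ hG₀) hv he hlam
  rw [hp, hq] at h
  have hn0 : (0 : ℝ) < n := by exact_mod_cast hn
  have hN : (0 : ℝ) < Fintype.card (Node n ℓ) :=
    Nat.cast_pos.2 (Fintype.card_pos_iff.2 ⟨Sum.inl (0, none)⟩)
  refine le_one_sub_of_one_le hn0 (by positivity) h (by positivity) ?_
  have hN' : (Fintype.card (Node n ℓ) : ℝ) ≤ 3 * (n : ℝ) ^ 2 := by
    exact_mod_cast card_node_le hn ℓ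
  refine (mixing_bound_le hN.le hN' p q).trans (le_of_eq ?_)
  push_cast
  rfl

end gap

/-- Rapid mixing (spectral gap form) of the degree interval Markov chain on `G(ℓ,u)`
for near-regular degree intervals of size at most one: every eigenvalue `λ ≠ 1` of its
transition matrix satisfies `λ ≤ 1 − 1/(c·n^k)`. -/
theorem degree_interval_chain_rapid_mixing (α ρ : ℝ) (hα0 : 0 < α) (hα : α < 1 / 2)
    (hρ0 : 0 < ρ) (hρ : ρ < 1) :
    ∃ c k n₀ : ℕ, 0 < c ∧ ∀ n : ℕ, n₀ ≤ n → ∀ r : ℕ, 2 ≤ r → (r : ℝ) ≤ (1 - ρ) * n →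
      ∀ ℓ u : Fin n → ℕ,
        (∀ i, ℓ i ≤ u i ∧ (r : ℝ) - (r : ℝ) ^ α ≤ (ℓ i : ℝ) ∧
          (u i : ℝ) ≤ (r : ℝ) + (r : ℝ) ^ α ∧ u i ≤ ℓ i + 1) →
        ∀ (lam : ℝ) (v : {G : SimpleGraph (Fin n) // memGlu n ℓ u G} → ℝ),
          v ≠ 0 → IsEigenPair (diMatrix n ℓ u) lam v → lam ≠ 1 →
            lam ≤ 1 - 1 / ((c : ℝ) * (n : ℝ) ^ k) := by
  obtain ⟨n₀, hn₀⟩ := exists_repairCond hρ0 hρ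
  obtain ⟨c, k, hc, hgap⟩ := exists_gap_of_repairable 100
  refine ⟨c, k, n₀ + 1, hc, fun n hn r hr hrn ℓ u h => ?_⟩
  refine hgap n (by omega) ℓ u (fun i => ⟨(h i).1, (h i).2.2.2⟩) fun G₀ hG₀ G b h1 h2 hb => ?_
  have hr2 : (2 : ℝ) ≤ r := by exact_mod_cast hr
  have hs : (r : ℝ) ^ α ≤ √r := by
    rw [Real.sqrt_eq_rpow]
    exact Real.rpow_le_rpow_of_exponent_le (by linarith) hα.le
  have hs' : √(r : ℝ) < r := by
    rw [Real.sqrt_lt' (by linarith)]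
    nlinarith
  have hcond := hn₀ n (by omega) r ((r : ℝ) ^ α) (by positivity) hrn (by positivity) hs
  refine exists_repair (D := 4) hcond (fun i => ⟨(h i).1, (h i).2.2.2⟩) (fun v => ?_) (fun v => ?_)
    (fun v => Nat.le_floor (h v).2.2.1) hG₀ h1 h2 hb
  · have : (0 : ℝ) < ℓ v := by linarith [(h v).2.1]
    exact_mod_cast this
  · exact Nat.sub_le_sub_right (Nat.ceil_le.2 (h v).2.1) 10
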